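/- arXiv:0910.4533 — 2 statements merged into one kernel-verified Lean document; each statement's English description precedes it below -/
import Mathlib

section
/- For every s ∈ [0, 1/2], every b > 1/2 and every b̃ > 1/6 + (2/3)s there exists a constant C > 0, depending only on ν, μ, s, b and b̃, such that for all Schwartz functions u, v on ℝ² one has ‖I^{s}(u,v)‖_{L²(ℝ²)} ≤ C ‖u‖_{X_{0,b}} ‖v‖_{X_{0,b̃}}. (Interpolated bilinear estimate, Corollary 2.6.) -/
open MeasureTheory Real
open scoped ENNReal NNReal Classical

noncomputable section

/-- Phase function of the linear Benjamin equation: `φ(ξ) = -ν ξ|ξ| + μ ξ³`. -/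
def phase (ν μ ξ : ℝ) : ℝ := -ν * ξ * |ξ| + μ * ξ ^ 3

/-- Derivative of the phase: `φ'(ξ) = -2ν|ξ| + 3μξ²`. -/
def dphase (ν μ ξ : ℝ) : ℝ := -2 * ν * |ξ| + 3 * μ * ξ ^ 2

/-- The frequency threshold `a = 2·max(1, |2ν/(3μ)|)`. -/
def aconst (ν μ : ℝ) : ℝ := 2 * max 1 |2 * ν / (3 * μ)|

/-- Fourier transform in the space variable. -/
def FT (f : ℝ → ℂ) (ξ : ℝ) : ℂ := ∫ x : ℝ, Complex.exp (-(Complex.I * ξ * x)) * f x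

/-- Space-time Fourier transform. -/
def FT2 (u : ℝ → ℝ → ℂ) (ξ τ : ℝ) : ℂ :=
  ∫ x : ℝ, ∫ t : ℝ, Complex.exp (-(Complex.I * (ξ * x + τ * t))) * u x t

/-- Mixed norm `‖f‖_{L^p_x L^q_t}` (with exponents in `ℝ≥0∞`). -/
def mixedLpLq (p q : ℝ≥0∞) (f : ℝ → ℝ → ℂ) : ℝ≥0∞ :=
  if p = ∞ then essSup (fun x => eLpNorm (f x) q volume) volume
  else (∫⁻ x : ℝ, eLpNorm (f x) q volume ^ p.toReal) ^ (1 / p.toReal)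

/-- The Bourgain norm `‖u‖_{X_{s,b}}` associated to the Benjamin phase function. -/
def XNorm (ν μ s b : ℝ) (u : ℝ → ℝ → ℂ) : ℝ≥0∞ :=
  (∫⁻ ξ : ℝ, ∫⁻ τ : ℝ,
      ENNReal.ofReal ((1 + ξ ^ 2) ^ s * (1 + (τ - phase ν μ ξ) ^ 2) ^ b) *
        (‖FT2 u ξ τ‖₊ : ℝ≥0∞) ^ 2) ^ (1 / 2 : ℝ)

/-- The free Benjamin group `S(t)` applied to initial data `u₀`, as a function of `(x,t)`. -/
def Sgrp (ν μ : ℝ) (u₀ : ℝ → ℂ) (x t : ℝ) : ℂ :=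
  (2 * π)⁻¹ • ∫ ξ : ℝ, Complex.exp (Complex.I * (ξ * x + phase ν μ ξ * t)) * FT u₀ ξ

/-- `D_x^α S(t) P^a u₀` : the Benjamin group composed with the Fourier restriction
`P^a` to `{|ξ| ≥ a}` and the derivative operator `D_x^α`. -/
def DSgrpPa (ν μ α : ℝ) (u₀ : ℝ → ℂ) (x t : ℝ) : ℂ :=
  (2 * π)⁻¹ • ∫ ξ : ℝ,
    if aconst ν μ ≤ |ξ| then
      (↑(|ξ| ^ α) : ℂ) * Complex.exp (Complex.I * (ξ * x + phase ν μ ξ * t)) * FT u₀ ξ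
    else 0

/-- `D_x^α P^a F` acting in the space variable of a space-time function `F`. -/
def DPa (ν μ α : ℝ) (F : ℝ → ℝ → ℂ) (x t : ℝ) : ℂ :=
  (2 * π)⁻¹ • ∫ ξ : ℝ,
    if aconst ν μ ≤ |ξ| then
      (↑(|ξ| ^ α) : ℂ) * Complex.exp (Complex.I * (ξ * x)) * FT (fun y => F y t) ξ
    else 0

/-- The space-time Fourier transform of the bilinear operator `I^s(u,v)`:
`(I^s(u,v))^(ξ,τ) = ∫ |φ'(ξ₁) - φ'(ξ₂)|^s û(ξ₁,τ₁) v̂(ξ₂,τ₂)` over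
`ξ₁ + ξ₂ = ξ`, `τ₁ + τ₂ = τ`. -/
def IsHat (ν μ s : ℝ) (u v : ℝ → ℝ → ℂ) (ξ τ : ℝ) : ℂ :=
  ∫ ξ₁ : ℝ, ∫ τ₁ : ℝ,
    (↑(|dphase ν μ ξ₁ - dphase ν μ (ξ - ξ₁)| ^ s) : ℂ) *
      (FT2 u ξ₁ τ₁ * FT2 v (ξ - ξ₁) (τ - τ₁))

/-- The bilinear operator `I^s(u,v)`, recovered from its space-time Fourier
transform by the inverse Fourier transform. -/
def IsOp (ν μ s : ℝ) (u v : ℝ → ℝ → ℂ) (x t : ℝ) : ℂ :=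
  ((2 * π) ^ 2)⁻¹ • ∫ ξ : ℝ, ∫ τ : ℝ,
    Complex.exp (Complex.I * (ξ * x + τ * t)) * IsHat ν μ s u v ξ τ

theorem eLpNorm_two_sq {α E : Type*} [MeasurableSpace α] [NormedAddCommGroup E] (m : Measure α)
    (f : α → E) : eLpNorm f 2 m ^ 2 = ∫⁻ x, ‖f x‖ₑ ^ 2 ∂m := by
  rw [eLpNorm_eq_lintegral_rpow_enorm_toReal (by norm_num) (by norm_num)]
  simp only [ENNReal.toReal_ofNat, ENNReal.rpow_ofNat]
  rw [← ENNReal.rpow_natCast, ← ENNReal.rpow_mul]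
  norm_num

open FourierTransform in
/-- On `L¹ ∩ L²` the integral Fourier transform agrees with the `L²` Fourier transform. -/
theorem fourier_toLp_ae_eq {h : ℝ → ℂ} (h1 : Integrable h) (h2 : MemLp h 2) :
    ((𝓕 (h2.toLp h) : Lp ℂ 2 (volume : Measure ℝ)) : ℝ → ℂ) =ᵐ[volume] 𝓕 h := by
  refine ae_eq_of_integral_contDiff_smul_eq
    ((Lp.memLp _).locallyIntegrable (by norm_num))
    (Continuous.locallyIntegrable ?_) ?_
  · exact VectorFourier.fourierIntegral_continuous Real.continuous_fourierChar
      (L := innerₗ ℝ) continuous_inner h1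
  · intro g hg hgc
    have hc : HasCompactSupport (fun x => (g x : ℂ)) := hgc.comp_left (g := Complex.ofReal) rfl
    have hd : ContDiff ℝ (⊤ : ℕ∞) (fun x => (g x : ℂ)) := Complex.ofRealCLM.contDiff.comp hg
    have key := congrArg (fun T => T (hc.toSchwartzMap hd))
      (Lp.fourier_toTemperedDistribution_eq (h2.toLp h))
    simp only [TemperedDistribution.fourier_apply, Lp.toTemperedDistribution_apply] at key
    have e1 : ∫ x, g x • ((𝓕 (h2.toLp h) : Lp ℂ 2 (volume : Measure ℝ)) : ℝ → ℂ) x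
        = ∫ x, (hc.toSchwartzMap hd) x •
          ((𝓕 (h2.toLp h) : Lp ℂ 2 (volume : Measure ℝ)) : ℝ → ℂ) x := by
      congr 1
    have e2 : ∫ x, g x • 𝓕 h x = ∫ x, (hc.toSchwartzMap hd) x • 𝓕 h x := by
      congr 1
    rw [e1, e2, ← key]
    have e3 : ∫ x, (𝓕 (hc.toSchwartzMap hd)) x • (h2.toLp h) x
        = ∫ x, (𝓕 (hc.toSchwartzMap hd)) x • h x := by
      refine integral_congr_ae ?_
      filter_upwards [h2.coeFn_toLp] with x hx
      rw [hx]
    rw [e3]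
    have := VectorFourier.integral_fourierIntegral_smul_eq_flip (L := innerₗ ℝ) (μ := volume)
      (ν := volume) Real.continuous_fourierChar continuous_inner
      (hc.toSchwartzMap hd).integrable h1
    simpa using! this

open FourierTransform in
theorem lintegral_enorm_fourier_sq_le (h : ℝ → ℂ) :
    ∫⁻ x, ‖𝓕 h x‖ₑ ^ 2 ≤ ∫⁻ x, ‖h x‖ₑ ^ 2 := by
  by_cases h1 : Integrable h
  · by_cases h2 : eLpNorm h 2 = ⊤
    · rw [← eLpNorm_two_sq, ← eLpNorm_two_sq, h2]
      simp
    · have hm : MemLp h 2 := ⟨h1.1, lt_top_iff_ne_top.2 h2⟩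
      rw [← eLpNorm_two_sq, ← eLpNorm_two_sq, ← eLpNorm_congr_ae (fourier_toLp_ae_eq h1 hm),
        ← eLpNorm_congr_ae hm.coeFn_toLp, ← Lp.enorm_def, ← Lp.enorm_def]
      rw [← ofReal_norm, ← ofReal_norm, Lp.norm_fourier_eq]
  · have : ∀ x, 𝓕 h x = 0 := fun x => by
      rw [Real.fourier_eq]
      refine integral_undef fun hi => h1 ?_
      exact (Real.fourierIntegral_convergent_iff x).1 hi
    simp [this]

/-- One-dimensional Plancherel bound for the inverse Fourier integral. No integrability is needed,
since the Bochner integral of a non-integrable function vanishes. -/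
theorem lintegral_enorm_integral_exp_sq_le (h : ℝ → ℂ) :
    ∫⁻ x : ℝ, ‖∫ t : ℝ, Complex.exp (Complex.I * (x * t)) * h t‖ₑ ^ 2
      ≤ ENNReal.ofReal (2 * π) * ∫⁻ t, ‖h t‖ₑ ^ 2 := by
  have hpi : (-(2 * π))⁻¹ ≠ 0 := inv_ne_zero (neg_ne_zero.2 (by positivity))
  have e : ∀ x : ℝ, ∫ t : ℝ, Complex.exp (Complex.I * (x * t)) * h t
      = FourierTransform.fourier h ((-(2 * π))⁻¹ * x) := fun x => by
    rw [Real.fourier_eq']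
    congr 1
    ext t
    rw [smul_eq_mul]
    congr 2
    simp only [RCLike.inner_apply, conj_trivial]
    have : (π : ℂ) ≠ 0 := by exact_mod_cast Real.pi_ne_zero
    push_cast
    field_simp
  simp only [e]
  have hs : ∫⁻ x : ℝ, ‖FourierTransform.fourier h ((-(2 * π))⁻¹ * x)‖ₑ ^ 2
      = ENNReal.ofReal (2 * π) * ∫⁻ y, ‖FourierTransform.fourier h y‖ₑ ^ 2 := by
    have hm : MeasurableEmbedding (fun x : ℝ => (-(2 * π))⁻¹ * x) :=
      (Homeomorph.mulLeft₀ _ hpi).measurableEmbedding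
    rw [← hm.lintegral_map (fun y => ‖FourierTransform.fourier h y‖ₑ ^ 2),
      Real.map_volume_mul_left hpi, lintegral_smul_measure, inv_inv, abs_neg,
      abs_of_pos (by positivity), smul_eq_mul]
  rw [hs]
  exact mul_le_mul' le_rfl (lintegral_enorm_fourier_sq_le h)

theorem stronglyMeasurable_partialFourier {h : ℝ → ℝ → ℂ} (hh : Measurable (Function.uncurry h)) :
    StronglyMeasurable fun p : ℝ × ℝ =>
      ∫ τ : ℝ, Complex.exp (Complex.I * ((p.2 : ℂ) * τ)) * h p.1 τ := by
  refine StronglyMeasurable.integral_prod_right'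
    (f := fun q : (ℝ × ℝ) × ℝ => Complex.exp (Complex.I * ((q.1.2 : ℂ) * q.2)) * h q.1.1 q.2) ?_
  refine Measurable.stronglyMeasurable ?_
  refine Measurable.mul (by fun_prop) ?_
  exact hh.comp (f := fun q : (ℝ × ℝ) × ℝ => (q.1.1, q.2)) (by fun_prop)

/-- Two-dimensional Plancherel bound for the iterated inverse Fourier integral. -/
theorem lintegral_enorm_iterated_integral_exp_sq_le {h : ℝ → ℝ → ℂ}
    (hh : Measurable (Function.uncurry h)) :
    ∫⁻ z : ℝ × ℝ, ‖∫ ξ : ℝ, ∫ τ : ℝ,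
        Complex.exp (Complex.I * (ξ * z.1 + τ * z.2)) * h ξ τ‖ₑ ^ 2
      ≤ ENNReal.ofReal (2 * π) ^ 2 * ∫⁻ z : ℝ × ℝ, ‖h z.1 z.2‖ₑ ^ 2 := by
  obtain ⟨k, hk⟩ : ∃ k : ℝ → ℝ → ℂ, k = fun (ξ t : ℝ) =>
    ∫ τ : ℝ, Complex.exp (Complex.I * ((t : ℂ) * τ)) * h ξ τ := ⟨_, rfl⟩
  have hkm : Measurable (Function.uncurry k) := by
    rw [hk]
    exact (stronglyMeasurable_partialFourier hh).measurable
  have hks : Measurable (Function.uncurry fun t ξ => k ξ t) :=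
    hkm.comp (g := Function.uncurry k) measurable_swap
  have e : ∀ z : ℝ × ℝ, ∫ ξ : ℝ, ∫ τ : ℝ, Complex.exp (Complex.I * (ξ * z.1 + τ * z.2)) * h ξ τ
      = ∫ ξ : ℝ, Complex.exp (Complex.I * ((z.1 : ℂ) * ξ)) * k ξ z.2 := fun z => by
    congr 1
    ext ξ
    rw [hk, ← integral_const_mul]
    congr 1
    ext τ
    rw [← mul_assoc, ← Complex.exp_add]
    congr 2
    ring
  simp only [e]
  have hKm : Measurable fun z : ℝ × ℝ =>
      ‖∫ ξ : ℝ, Complex.exp (Complex.I * ((z.1 : ℂ) * ξ)) * k ξ z.2‖ₑ ^ 2 := by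
    exact ((stronglyMeasurable_partialFourier hks).measurable.comp measurable_swap).enorm.pow_const 2
  rw [Measure.volume_eq_prod, lintegral_prod_symm _ hKm.aemeasurable]
  calc ∫⁻ t : ℝ, ∫⁻ x : ℝ, ‖∫ ξ : ℝ, Complex.exp (Complex.I * ((x : ℂ) * ξ)) * k ξ t‖ₑ ^ 2
      ≤ ∫⁻ t : ℝ, ENNReal.ofReal (2 * π) * ∫⁻ ξ, ‖k ξ t‖ₑ ^ 2 :=
        lintegral_mono fun t => lintegral_enorm_integral_exp_sq_le fun ξ => k ξ t
    _ = ENNReal.ofReal (2 * π) * ∫⁻ ξ, ∫⁻ t, ‖k ξ t‖ₑ ^ 2 := by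
        rw [lintegral_const_mul' _ _ ENNReal.ofReal_ne_top,
          lintegral_lintegral_swap (f := fun t ξ => ‖k ξ t‖ₑ ^ 2)]
        exact (hks.enorm.pow_const 2).aemeasurable
    _ ≤ ENNReal.ofReal (2 * π) * ∫⁻ ξ, ENNReal.ofReal (2 * π) * ∫⁻ τ, ‖h ξ τ‖ₑ ^ 2 := by
        refine mul_le_mul' le_rfl (lintegral_mono fun ξ => ?_)
        rw [hk]
        exact lintegral_enorm_integral_exp_sq_le fun τ => h ξ τ
    _ = ENNReal.ofReal (2 * π) ^ 2 * ∫⁻ z : ℝ × ℝ, ‖h z.1 z.2‖ₑ ^ 2 ∂(volume.prod volume) := by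
        rw [lintegral_const_mul' _ _ ENNReal.ofReal_ne_top, ← mul_assoc, ← pow_two,
          lintegral_prod (fun z : ℝ × ℝ => ‖h z.1 z.2‖ₑ ^ 2) (hh.enorm.pow_const 2).aemeasurable]

theorem hasDerivAt_phase (ν μ x : ℝ) : HasDerivAt (phase ν μ) (dphase ν μ x) x := by
  have habs : HasDerivAt (fun y : ℝ => y * |y|) (2 * |x|) x := by
    rcases lt_trichotomy x 0 with hx | rfl | hx
    · have := (hasDerivAt_id x).mul (hasDerivAt_abs_neg hx)
      refine this.congr_deriv ?_
      rw [abs_of_neg hx]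
      simp
      ring
    · rw [hasDerivAt_iff_tendsto_slope_zero]
      have : Filter.Tendsto (fun t : ℝ => |t|) (nhdsWithin 0 {0}ᶜ) (nhds (2 * |0|)) := by
        have := continuous_abs.tendsto (0 : ℝ)
        simpa using this.mono_left nhdsWithin_le_nhds
      refine this.congr' ?_
      filter_upwards [self_mem_nhdsWithin] with t ht
      have : t ≠ 0 := ht
      simp
      field_simp
    · have := (hasDerivAt_id x).mul (hasDerivAt_abs_pos hx)
      refine this.congr_deriv ?_
      rw [abs_of_pos hx]
      simp
      ring
  have h := (habs.const_mul (-ν)).add ((hasDerivAt_pow 3 x).const_mul μ)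
  have e : phase ν μ = fun y => -ν * (y * |y|) + μ * y ^ 3 := by
    ext y
    simp only [phase]
    ring
  rw [e]
  refine h.congr_deriv ?_
  simp only [dphase]
  push_cast
  ring

theorem continuous_phase (ν μ : ℝ) : Continuous (phase ν μ) := by
  unfold phase
  fun_prop

theorem continuous_dphase (ν μ : ℝ) : Continuous (dphase ν μ) := by
  unfold dphase
  fun_prop

/-- On a convex set where the derivative has constant sign, the total variation of a function is
bounded by the length of the window in which it takes its values. -/
theorem setLIntegral_abs_deriv_le_of_sign {G G' : ℝ → ℝ} (hG : ∀ x, HasDerivAt G (G' x) x)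
    {S : Set ℝ} (hS : Convex ℝ S) (hSm : MeasurableSet S)
    (hsign : (∀ x ∈ S, 0 ≤ G' x) ∨ (∀ x ∈ S, G' x ≤ 0)) (τ M : ℝ) :
    ∫⁻ x in S ∩ {x | |τ - G x| ≤ M}, ENNReal.ofReal |G' x| ≤ ENNReal.ofReal (2 * M) := by
  have hc : Continuous G := continuous_iff_continuousAt.2 fun x => (hG x).continuousAt
  have hE : MeasurableSet {x | |τ - G x| ≤ M} :=
    (isClosed_le (by fun_prop) continuous_const).measurableSet
  have himg : volume (G '' (S ∩ {x | |τ - G x| ≤ M})) ≤ ENNReal.ofReal (2 * M) := by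
    have : G '' (S ∩ {x | |τ - G x| ≤ M}) ⊆ Set.Icc (τ - M) (τ + M) := by
      rintro _ ⟨x, ⟨_, hx : |τ - G x| ≤ M⟩, rfl⟩
      have := abs_le.1 hx
      constructor <;> linarith
    refine (measure_mono this).trans ?_
    rw [Real.volume_Icc]
    apply le_of_eq
    congr 1
    ring
  rcases hsign with h | h
  · have hmono : MonotoneOn G S := by
      refine monotoneOn_of_deriv_nonneg hS hc.continuousOn
        (fun x _ => (hG x).differentiableAt.differentiableWithinAt) fun x hx => ?_
      rw [(hG x).deriv]
      exact h x (interior_subset hx)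
    refine le_trans (le_of_eq ?_) himg
    rw [← lintegral_deriv_eq_volume_image_of_monotoneOn (hSm.inter hE)
      (fun x _ => (hG x).hasDerivWithinAt) (hmono.mono Set.inter_subset_left)]
    refine setLIntegral_congr_fun (hSm.inter hE) fun x hx => ?_
    simp only [abs_of_nonneg (h x hx.1)]
  · have hmono : AntitoneOn G S := by
      refine antitoneOn_of_deriv_nonpos hS hc.continuousOn
        (fun x _ => (hG x).differentiableAt.differentiableWithinAt) fun x hx => ?_
      rw [(hG x).deriv]
      exact h x (interior_subset hx)
    refine le_trans (le_of_eq ?_) himg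
    rw [← lintegral_deriv_eq_volume_image_of_antitoneOn (hSm.inter hE)
      (fun x _ => (hG x).hasDerivWithinAt) (hmono.mono Set.inter_subset_left)]
    refine setLIntegral_congr_fun (hSm.inter hE) fun x hx => ?_
    simp only [abs_of_nonpos (h x hx.1)]

theorem sign_mul_of_sign {f g : ℝ → ℝ} {S : Set ℝ}
    (hf : (∀ x ∈ S, 0 ≤ f x) ∨ (∀ x ∈ S, f x ≤ 0)) (hg : (∀ x ∈ S, 0 ≤ g x) ∨ (∀ x ∈ S, g x ≤ 0)) :
    (∀ x ∈ S, 0 ≤ f x * g x) ∨ (∀ x ∈ S, f x * g x ≤ 0) := by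
  rcases hf with hf | hf <;> rcases hg with hg | hg
  · exact Or.inl fun x hx => mul_nonneg (hf x hx) (hg x hx)
  · exact Or.inr fun x hx => mul_nonpos_of_nonneg_of_nonpos (hf x hx) (hg x hx)
  · exact Or.inr fun x hx => mul_nonpos_of_nonpos_of_nonneg (hf x hx) (hg x hx)
  · exact Or.inl fun x hx => mul_nonneg_of_nonpos_of_nonpos (hf x hx) (hg x hx)

theorem dphase_sub_dphase (ν μ x y : ℝ) :
    dphase ν μ x - dphase ν μ y = (|x| - |y|) * (3 * μ * (|x| + |y|) - 2 * ν) := by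
  simp only [dphase, ← sq_abs x, ← sq_abs y]
  ring

theorem sign_abs_sub_abs {ξ : ℝ} {S : Set ℝ} (hS : (∀ a ∈ S, ξ / 2 ≤ a) ∨ (∀ a ∈ S, a ≤ ξ / 2)) :
    (∀ a ∈ S, 0 ≤ |a| - |ξ - a|) ∨ (∀ a ∈ S, |a| - |ξ - a| ≤ 0) := by
  have h1 : ∀ a, 0 ≤ ξ * (2 * a - ξ) → 0 ≤ |a| - |ξ - a| := fun a h =>
    sub_nonneg.2 (sq_le_sq.1 (by nlinarith))
  have h2 : ∀ a, ξ * (2 * a - ξ) ≤ 0 → |a| - |ξ - a| ≤ 0 := fun a h =>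
    sub_nonpos.2 (sq_le_sq.1 (by nlinarith))
  rcases hS with hS | hS <;> rcases le_total 0 ξ with hξ | hξ
  · exact Or.inl fun a ha => h1 a (mul_nonneg hξ (by linarith [hS a ha]))
  · exact Or.inr fun a ha => h2 a (mul_nonpos_of_nonpos_of_nonneg hξ (by linarith [hS a ha]))
  · exact Or.inr fun a ha => h2 a (mul_nonpos_of_nonneg_of_nonpos hξ (by linarith [hS a ha]))
  · exact Or.inl fun a ha => h1 a (mul_nonneg_of_nonpos_of_nonpos hξ (by linarith [hS a ha]))

theorem sign_abs_add_abs {q ξ : ℝ} {S : Set ℝ}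
    (hS : (∀ a ∈ S, |q| ≤ |a - ξ / 2|) ∨ (∀ a ∈ S, |a - ξ / 2| ≤ |q|)) :
    (∀ a ∈ S, 0 ≤ |a| + |ξ - a| - 2 * q) ∨ (∀ a ∈ S, |a| + |ξ - a| - 2 * q ≤ 0) := by
  have hξ : ∀ a, |ξ| ≤ |a| + |ξ - a| := fun a => by
    calc |ξ| = |a + (ξ - a)| := by ring_nf
      _ ≤ _ := abs_add_le _ _
  have hd : ∀ a, 2 * |a - ξ / 2| ≤ |a| + |ξ - a| := fun a => by
    calc 2 * |a - ξ / 2| = |2 * (a - ξ / 2)| := by rw [abs_mul]; norm_num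
      _ = |a - (ξ - a)| := by ring_nf
      _ ≤ _ := abs_sub _ _
  rcases hS with hS | hS
  · exact Or.inl fun a ha => by linarith [hS a ha, hd a, le_abs_self q]
  · rcases le_total (2 * q) |ξ| with h | h
    · exact Or.inl fun a _ => by linarith [hξ a]
    · right
      intro a ha
      have hq : 0 ≤ q := by linarith [abs_nonneg ξ]
      have h3 := hS a ha
      rw [abs_of_nonneg hq] at h3
      have h4 := abs_le.1 h3
      have h5 := abs_le.1 h
      rcases abs_cases a with h6 | h6 <;> rcases abs_cases (ξ - a) with h7 | h7 <;> linarith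

/-- The total variation of `a ↦ φ(a) + φ(ξ - a)` over a window of width `2M` of its values. -/
theorem setLIntegral_abs_dphase_sub_le {ν μ : ℝ} (hμ : μ ≠ 0) (ξ τ M : ℝ) :
    ∫⁻ a in {a | |τ - (phase ν μ a + phase ν μ (ξ - a))| ≤ M},
      ENNReal.ofReal |dphase ν μ a - dphase ν μ (ξ - a)| ≤ 4 * ENNReal.ofReal (2 * M) := by
  set q := ν / (3 * μ) with hq
  have hG : ∀ a, HasDerivAt (fun a => phase ν μ a + phase ν μ (ξ - a))
      (dphase ν μ a - dphase ν μ (ξ - a)) a := fun a => by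
    have := (hasDerivAt_phase ν μ a).add
      ((hasDerivAt_phase ν μ (ξ - a)).comp a ((hasDerivAt_id a).const_sub ξ))
    refine this.congr_deriv ?_
    ring
  have piece : ∀ S : Set ℝ, Convex ℝ S → MeasurableSet S →
      ((∀ a ∈ S, ξ / 2 ≤ a) ∨ (∀ a ∈ S, a ≤ ξ / 2)) →
      ((∀ a ∈ S, |q| ≤ |a - ξ / 2|) ∨ (∀ a ∈ S, |a - ξ / 2| ≤ |q|)) →
      ∫⁻ a in S ∩ {a | |τ - (phase ν μ a + phase ν μ (ξ - a))| ≤ M},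
        ENNReal.ofReal |dphase ν μ a - dphase ν μ (ξ - a)| ≤ ENNReal.ofReal (2 * M) := by
    intro S hS hSm h1 h2
    refine setLIntegral_abs_deriv_le_of_sign hG hS hSm ?_ τ M
    have e : ∀ a, dphase ν μ a - dphase ν μ (ξ - a)
        = 3 * μ * ((|a| - |ξ - a|) * (|a| + |ξ - a| - 2 * q)) := fun a => by
      rw [dphase_sub_dphase, hq]
      field_simp
    simp only [e]
    refine sign_mul_of_sign (f := fun _ => 3 * μ) ?_
      (sign_mul_of_sign (sign_abs_sub_abs h1) (sign_abs_add_abs h2))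
    rcases le_total 0 μ with h | h
    · exact Or.inl fun _ _ => by linarith
    · exact Or.inr fun _ _ => by linarith
  set E := {a | |τ - (phase ν μ a + phase ν μ (ξ - a))| ≤ M} with hE
  have hq0 := abs_nonneg q
  have p1 := piece (Set.Iic (ξ / 2 - |q|)) (convex_Iic _) measurableSet_Iic
    (Or.inr fun a (ha : a ≤ _) => by linarith)
    (Or.inl fun a (ha : a ≤ _) => by rw [abs_of_nonpos (a := a - ξ / 2)] <;> linarith)
  have p2 := piece (Set.Icc (ξ / 2 - |q|) (ξ / 2)) (convex_Icc _ _) measurableSet_Icc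
    (Or.inr fun a ha => ha.2)
    (Or.inr fun a ha => by rw [abs_le]; constructor <;> linarith [ha.1, ha.2])
  have p3 := piece (Set.Icc (ξ / 2) (ξ / 2 + |q|)) (convex_Icc _ _) measurableSet_Icc
    (Or.inl fun a ha => ha.1)
    (Or.inr fun a ha => by rw [abs_le]; constructor <;> linarith [ha.1, ha.2])
  have p4 := piece (Set.Ici (ξ / 2 + |q|)) (convex_Ici _) measurableSet_Ici
    (Or.inl fun a (ha : _ ≤ a) => by linarith)
    (Or.inl fun a (ha : _ ≤ a) => by rw [abs_of_nonneg (a := a - ξ / 2)] <;> linarith)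
  have hcov : E ⊆ (Set.Iic (ξ / 2 - |q|) ∩ E ∪ Set.Icc (ξ / 2 - |q|) (ξ / 2) ∩ E) ∪
      (Set.Icc (ξ / 2) (ξ / 2 + |q|) ∩ E ∪ Set.Ici (ξ / 2 + |q|) ∩ E) := by
    intro a ha
    rcases le_total a (ξ / 2) with h | h
    · rcases le_total a (ξ / 2 - |q|) with h' | h'
      · exact Or.inl (Or.inl ⟨h', ha⟩)
      · exact Or.inl (Or.inr ⟨⟨h', h⟩, ha⟩)
    · rcases le_total a (ξ / 2 + |q|) with h' | h'
      · exact Or.inr (Or.inl ⟨⟨h, h'⟩, ha⟩)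
      · exact Or.inr (Or.inr ⟨h', ha⟩)
  refine (lintegral_mono_set hcov).trans ?_
  refine (lintegral_union_le _ _ _).trans ?_
  refine (add_le_add ((lintegral_union_le _ _ _).trans (add_le_add p1 p2))
    ((lintegral_union_le _ _ _).trans (add_le_add p3 p4))).trans (le_of_eq ?_)
  ring

theorem volume_phase_window_le {ν μ : ℝ} (hμ : μ ≠ 0) {m ξ : ℝ} (hm : 1 ≤ m)
    (hξ : (1 + 4 * |ν / (3 * μ)|) * m ≤ |ξ|) (τ : ℝ) :
    volume {a | |τ - (phase ν μ a + phase ν μ (ξ - a))| ≤ m ^ 3}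
      ≤ ENNReal.ofReal ((2 + 16 / (3 * |μ|)) * m) := by
  set q := ν / (3 * μ) with hq
  set E := {a | |τ - (phase ν μ a + phase ν μ (ξ - a))| ≤ m ^ 3} with hE
  have hμ' : 0 < |μ| := abs_pos.2 hμ
  have hq0 := abs_nonneg q
  set l := 3 / 2 * |μ| * m ^ 2 with hl
  have hl0 : 0 < l := by positivity
  have hEm : MeasurableSet E := by
    have := continuous_phase ν μ
    exact (isClosed_le (by fun_prop) continuous_const).measurableSet
  have hlow : ∀ a, m ≤ |a - ξ / 2| → l ≤ |dphase ν μ a - dphase ν μ (ξ - a)| := by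
    intro a ha
    have e : dphase ν μ a - dphase ν μ (ξ - a)
        = 3 * μ * ((|a| - |ξ - a|) * (|a| + |ξ - a| - 2 * q)) := by
      rw [dphase_sub_dphase, hq]
      field_simp
    have h1 : |ξ| ≤ |a| + |ξ - a| := by
      calc |ξ| = |a + (ξ - a)| := by ring_nf
        _ ≤ _ := abs_add_le _ _
    have hmξ : m ≤ |ξ| := by nlinarith
    have h2 : m ≤ |(|a| - |ξ - a|)| := by
      have h3 : 2 * m ≤ |2 * a - ξ| := by
        have : 2 * a - ξ = 2 * (a - ξ / 2) := by ring
        rw [this, abs_mul, abs_two]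
        linarith
      rcases le_total 0 a with h4 | h4 <;> rcases le_total 0 (ξ - a) with h5 | h5
      · rw [abs_of_nonneg h4, abs_of_nonneg h5, show a - (ξ - a) = 2 * a - ξ by ring]
        linarith
      · rw [abs_of_nonneg h4, abs_of_nonpos h5, show a - -(ξ - a) = ξ by ring]
        exact hmξ
      · rw [abs_of_nonpos h4, abs_of_nonneg h5, show -a - (ξ - a) = -ξ by ring, abs_neg]
        exact hmξ
      · rw [abs_of_nonpos h4, abs_of_nonpos h5, show -a - -(ξ - a) = -(2 * a - ξ) by ring, abs_neg]
        linarith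
    have h6 : m / 2 ≤ |a| + |ξ - a| - 2 * q := by
      have : 4 * |q| ≤ 4 * |q| * m := by nlinarith
      linarith [le_abs_self q]
    rw [e, abs_mul, abs_mul, abs_mul, abs_of_pos (show (0 : ℝ) < 3 by norm_num),
      abs_of_nonneg (show 0 ≤ |a| + |ξ - a| - 2 * q by linarith)]
    calc l = 3 * |μ| * (m * (m / 2)) := by rw [hl]; ring
      _ ≤ _ := by gcongr
  have hcov : E ⊆ Set.Icc (ξ / 2 - m) (ξ / 2 + m) ∪
      {a | a ∈ E ∧ ENNReal.ofReal l ≤ ENNReal.ofReal |dphase ν μ a - dphase ν μ (ξ - a)|} := by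
    intro a ha
    rcases le_total |a - ξ / 2| m with h | h
    · left
      have := abs_le.1 h
      constructor <;> linarith
    · exact Or.inr ⟨ha, ENNReal.ofReal_le_ofReal (hlow a h)⟩
  have hcheb : volume {a | a ∈ E ∧
      ENNReal.ofReal l ≤ ENNReal.ofReal |dphase ν μ a - dphase ν μ (ξ - a)|}
      ≤ ENNReal.ofReal (8 * m ^ 3 / l) := by
    have hmeas : Measurable fun a => ENNReal.ofReal |dphase ν μ a - dphase ν μ (ξ - a)| := by
      have := continuous_dphase ν μ
      exact Measurable.ennreal_ofReal (Continuous.measurable (by fun_prop))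
    have h := mul_meas_ge_le_lintegral (μ := volume.restrict E) hmeas (ENNReal.ofReal l)
    rw [Measure.restrict_apply (measurableSet_le measurable_const hmeas)] at h
    have h2 := h.trans (setLIntegral_abs_dphase_sub_le hμ ξ τ (m ^ 3))
    have h3 : {a | ENNReal.ofReal l ≤ ENNReal.ofReal |dphase ν μ a - dphase ν μ (ξ - a)|} ∩ E
        = {a | a ∈ E ∧
          ENNReal.ofReal l ≤ ENNReal.ofReal |dphase ν μ a - dphase ν μ (ξ - a)|} := by
      ext a
      exact and_comm
    rw [h3, mul_comm] at h2
    rw [ENNReal.ofReal_div_of_pos hl0]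
    refine (ENNReal.le_div_iff_mul_le (Or.inl (by simpa using hl0))
      (Or.inl ENNReal.ofReal_ne_top)).2 (h2.trans (le_of_eq ?_))
    rw [show (4 : ℝ≥0∞) = ENNReal.ofReal 4 by simp, ← ENNReal.ofReal_mul (by norm_num)]
    congr 1
    ring
  refine (measure_mono hcov).trans ((measure_union_le _ _).trans ?_)
  refine (add_le_add (le_of_eq Real.volume_Icc) hcheb).trans (le_of_eq ?_)
  rw [← ENNReal.ofReal_add (by linarith) (by positivity)]
  congr 1
  rw [hl]
  field_simp
  ring

/-- The Schur-type bound for the symbol `|φ'(a) - φ'(ξ - a)|^{2s}` on a window of the resonance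
function, either for high output frequency or with `a` confined to a short set. -/
theorem exists_setLIntegral_symbol_le {ν μ : ℝ} (hμ : μ ≠ 0) {s : ℝ} (hs0 : 0 ≤ s)
    (hs1 : s ≤ 1 / 2) : ∃ K > (0 : ℝ), ∃ C > (0 : ℝ), ∀ m ≥ (1 : ℝ), ∀ ξ τ : ℝ, ∀ I : Set ℝ,
      (K * m ≤ |ξ| ∨ volume I ≤ ENNReal.ofReal (K * m)) →
      ∫⁻ a in I ∩ {a | |τ - (phase ν μ a + phase ν μ (ξ - a))| ≤ m ^ 3},
        ENNReal.ofReal |dphase ν μ a - dphase ν μ (ξ - a)| ^ (2 * s)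
        ≤ ENNReal.ofReal (C * m ^ (1 + 4 * s)) := by
  have hμ' : 0 < |μ| := abs_pos.2 hμ
  set K := 1 + 4 * |ν / (3 * μ)| with hK
  have hK0 : 0 < K := by positivity
  set D := max K (2 + 16 / (3 * |μ|)) with hD
  have hD0 : 0 < D := lt_max_of_lt_left hK0
  refine ⟨K, hK0, 8 ^ (2 * s) * D ^ (1 - 2 * s), by positivity, fun m hm ξ τ I hI => ?_⟩
  have hm0 : 0 < m := by linarith
  set E := {a | |τ - (phase ν μ a + phase ν μ (ξ - a))| ≤ m ^ 3} with hE
  have hvol : volume (I ∩ E) ≤ ENNReal.ofReal (D * m) := by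
    rcases hI with h | h
    · refine (measure_mono Set.inter_subset_right).trans
        ((volume_phase_window_le hμ hm h τ).trans (ENNReal.ofReal_le_ofReal ?_))
      exact mul_le_mul_of_nonneg_right (le_max_right _ _) hm0.le
    · refine (measure_mono Set.inter_subset_left).trans (h.trans (ENNReal.ofReal_le_ofReal ?_))
      exact mul_le_mul_of_nonneg_right (le_max_left _ _) hm0.le
  have htv : ∫⁻ a in I ∩ E, ENNReal.ofReal |dphase ν μ a - dphase ν μ (ξ - a)|
      ≤ ENNReal.ofReal (8 * m ^ 3) := by
    refine (lintegral_mono_set Set.inter_subset_right).trans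
      ((setLIntegral_abs_dphase_sub_le hμ ξ τ (m ^ 3)).trans (le_of_eq ?_))
    rw [show (4 : ℝ≥0∞) = ENNReal.ofReal 4 by simp, ← ENNReal.ofReal_mul (by norm_num)]
    congr 1
    ring
  have hmeas : Measurable fun a => ENNReal.ofReal |dphase ν μ a - dphase ν μ (ξ - a)| := by
    have := continuous_dphase ν μ
    exact Measurable.ennreal_ofReal (Continuous.measurable (by fun_prop))
  have hH := ENNReal.lintegral_mul_norm_pow_le (μ := volume.restrict (I ∩ E)) (p := 2 * s)
    (q := 1 - 2 * s) hmeas.aemeasurable (aemeasurable_const (b := (1 : ℝ≥0∞))) (by linarith)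
    (by linarith) (by ring)
  simp only [ENNReal.one_rpow, mul_one, lintegral_const, one_mul, Measure.restrict_apply_univ] at hH
  refine hH.trans ?_
  refine (mul_le_mul' (ENNReal.rpow_le_rpow htv (by linarith))
    (ENNReal.rpow_le_rpow hvol (by linarith))).trans (le_of_eq ?_)
  rw [ENNReal.ofReal_rpow_of_pos (by positivity), ENNReal.ofReal_rpow_of_pos (by positivity),
    ← ENNReal.ofReal_mul (by positivity)]
  congr 1
  rw [Real.mul_rpow (by norm_num) (by positivity), Real.mul_rpow hD0.le hm0.le,
    ← Real.rpow_natCast, ← Real.rpow_mul hm0.le,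
    show 1 + 4 * s = ((3 : ℕ) : ℝ) * (2 * s) + (1 - 2 * s) by push_cast; ring, Real.rpow_add hm0]
  ring

theorem sq_lintegral_mul_le {α : Type*} [MeasurableSpace α] (m : Measure α) {f g : α → ℝ≥0∞}
    (hf : AEMeasurable f m) (hg : AEMeasurable g m) :
    (∫⁻ a, f a * g a ∂m) ^ 2 ≤ (∫⁻ a, f a ^ 2 ∂m) * ∫⁻ a, g a ^ 2 ∂m := by
  have h := ENNReal.lintegral_mul_le_Lp_mul_Lq m Real.HolderConjugate.two_two hf hg
  have h2 := pow_le_pow_left₀ zero_le h 2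
  refine h2.trans (le_of_eq ?_)
  rw [mul_pow, ← ENNReal.rpow_natCast, ← ENNReal.rpow_natCast, ← ENNReal.rpow_mul,
    ← ENNReal.rpow_mul]
  norm_num

/-- Minkowski's integral inequality in `L²`, combined with the Cauchy–Schwarz inequality. -/
theorem lintegral_sq_lintegral_le {α β : Type*} [MeasurableSpace α] [MeasurableSpace β]
    (m : Measure α) (n : Measure β) [SFinite m] [SFinite n] {h : α → β → ℝ≥0∞}
    (hh : Measurable (Function.uncurry h)) {A : ℝ≥0∞} {p q : α → ℝ≥0∞} (hp : Measurable p)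
    (hq : Measurable q) (hb : ∀ c, ∫⁻ z, h c z ^ 2 ∂n ≤ A * (p c * q c)) :
    ∫⁻ z, (∫⁻ c, h c z ∂m) ^ 2 ∂n ≤ A * ((∫⁻ c, p c ∂m) * ∫⁻ c, q c ∂m) := by
  have hsq : ∀ x : ℝ≥0∞, (x ^ (1 / 2 : ℝ)) ^ 2 = x := fun x => by
    rw [← ENNReal.rpow_natCast, ← ENNReal.rpow_mul]
    norm_num
  have hr : ∀ x y : ℝ≥0∞, x ^ 2 ≤ y → x ≤ y ^ (1 / 2 : ℝ) := fun x y hxy => by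
    calc x = (x ^ 2) ^ (1 / 2 : ℝ) := by
          rw [← ENNReal.rpow_natCast, ← ENNReal.rpow_mul]
          norm_num
      _ ≤ _ := ENNReal.rpow_le_rpow hxy (by norm_num)
  have hc : ∀ c, Measurable (h c) := fun c => hh.comp measurable_prodMk_left
  have hz : ∀ z, Measurable fun c => h c z := fun z => hh.comp measurable_prodMk_right
  have hm : Measurable fun x : β × (α × α) => h x.2.1 x.1 * h x.2.2 x.1 :=
    (hh.comp (f := fun x : β × (α × α) => (x.2.1, x.1)) (by fun_prop)).mul
      (hh.comp (f := fun x : β × (α × α) => (x.2.2, x.1)) (by fun_prop))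
  have hpair : ∀ c c', ∫⁻ z, h c z * h c' z ∂n
      ≤ (A * (p c * q c)) ^ (1 / 2 : ℝ) * (A * (p c' * q c')) ^ (1 / 2 : ℝ) := fun c c' => by
    rw [← ENNReal.mul_rpow_of_nonneg _ _ (by norm_num)]
    exact hr _ _ ((sq_lintegral_mul_le n (hc c).aemeasurable (hc c').aemeasurable).trans
      (mul_le_mul' (hb c) (hb c')))
  have hrm : Measurable fun c => (A * (p c * q c)) ^ (1 / 2 : ℝ) := by fun_prop
  calc ∫⁻ z, (∫⁻ c, h c z ∂m) ^ 2 ∂n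
      = ∫⁻ z, ∫⁻ x : α × α, h x.1 z * h x.2 z ∂(m.prod m) ∂n := by
        refine lintegral_congr fun z => ?_
        rw [pow_two, lintegral_prod_mul (hz z).aemeasurable (hz z).aemeasurable]
    _ = ∫⁻ x : α × α, ∫⁻ z, h x.1 z * h x.2 z ∂n ∂(m.prod m) :=
        lintegral_lintegral_swap hm.aemeasurable
    _ ≤ ∫⁻ x : α × α, (A * (p x.1 * q x.1)) ^ (1 / 2 : ℝ) * (A * (p x.2 * q x.2)) ^ (1 / 2 : ℝ)
          ∂(m.prod m) := lintegral_mono fun x => hpair x.1 x.2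
    _ = (∫⁻ c, A ^ (1 / 2 : ℝ) * (p c ^ (1 / 2 : ℝ) * q c ^ (1 / 2 : ℝ)) ∂m) ^ 2 := by
        rw [lintegral_prod_mul hrm.aemeasurable hrm.aemeasurable, ← pow_two]
        simp only [ENNReal.mul_rpow_of_nonneg _ _ (show (0 : ℝ) ≤ 1 / 2 by norm_num)]
    _ ≤ A * ((∫⁻ c, p c ∂m) * ∫⁻ c, q c ∂m) := by
        rw [lintegral_const_mul _ (by fun_prop), mul_pow, hsq]
        refine mul_le_mul' le_rfl ((sq_lintegral_mul_le m (hp.pow_const _).aemeasurable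
          (hq.pow_const _).aemeasurable).trans (le_of_eq ?_))
        simp only [hsq]

theorem measurable_setLIntegral_window {α β : Type*} [MeasurableSpace α] [MeasurableSpace β]
    (n : Measure α) [SFinite n] {S : ℝ → Set α} (hS : MeasurableSet {p : ℝ × α | p.2 ∈ S p.1})
    {f : β → α → ℝ≥0∞} (hf : Measurable (Function.uncurry f)) :
    Measurable fun p : ℝ × β => ∫⁻ a in S p.1, f p.2 a ∂n := by
  have hSc : ∀ c, MeasurableSet (S c) := fun c => measurable_prodMk_left (x := c) hS
  have hm : Measurable fun q : (ℝ × β) × α =>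
      {p : ℝ × α | p.2 ∈ S p.1}.indicator (fun _ => (1 : ℝ≥0∞)) (q.1.1, q.2) * f q.1.2 q.2 :=
    ((measurable_const.indicator hS).comp (f := fun q : (ℝ × β) × α => (q.1.1, q.2))
      (by fun_prop)).mul (hf.comp (f := fun q : (ℝ × β) × α => (q.1.2, q.2)) (by fun_prop))
  have e : ∀ p : ℝ × β, ∫⁻ a in S p.1, f p.2 a ∂n
      = ∫⁻ a, {p : ℝ × α | p.2 ∈ S p.1}.indicator (fun _ => (1 : ℝ≥0∞)) (p.1, a) * f p.2 a ∂n := by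
    intro p
    rw [← lintegral_indicator (hSc p.1)]
    refine lintegral_congr fun a => ?_
    by_cases ha : a ∈ S p.1
    · simp [ha]
    · simp [ha]
  simp only [e]
  exact hm.lintegral_prod_right'

theorem lintegral_setLIntegral_window {α : Type*} [MeasurableSpace α]
    (n : Measure α) [SFinite n] {S : ℝ → Set α} (hS : MeasurableSet {p : ℝ × α | p.2 ∈ S p.1})
    {V : ℝ≥0∞} (hV : ∀ a, volume {c | a ∈ S c} = V) {f : α → ℝ≥0∞} (hf : Measurable f) :
    ∫⁻ c, ∫⁻ a in S c, f a ∂n = V * ∫⁻ a, f a ∂n := by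
  have hSc : ∀ c, MeasurableSet (S c) := fun c => measurable_prodMk_left (x := c) hS
  have hSa : ∀ a, MeasurableSet {c | a ∈ S c} := fun a => measurable_prodMk_right (y := a) hS
  have hm : Measurable fun q : ℝ × α =>
      {p : ℝ × α | p.2 ∈ S p.1}.indicator (fun _ => (1 : ℝ≥0∞)) q * f q.2 :=
    (measurable_const.indicator hS).mul (hf.comp measurable_snd)
  have e : ∀ c : ℝ, ∫⁻ a in S c, f a ∂n
      = ∫⁻ a, {p : ℝ × α | p.2 ∈ S p.1}.indicator (fun _ => (1 : ℝ≥0∞)) (c, a) * f a ∂n := by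
    intro c
    rw [← lintegral_indicator (hSc c)]
    refine lintegral_congr fun a => ?_
    by_cases ha : a ∈ S c
    · simp [ha]
    · simp [ha]
  simp only [e]
  rw [lintegral_lintegral_swap hm.aemeasurable, ← lintegral_const_mul _ hf]
  refine lintegral_congr fun a => ?_
  have hi : Measurable fun c : ℝ =>
      {p : ℝ × α | p.2 ∈ S p.1}.indicator (fun _ => (1 : ℝ≥0∞)) (c, a) :=
    (measurable_const.indicator hS).comp measurable_prodMk_right
  rw [lintegral_mul_const _ hi, ← hV a,
    ← lintegral_indicator_one (hSa a)]
  congr 1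

/-- Integrand of the bilinear operator with the first factor on the characteristic surface. -/
def surfaceIntegrand (ν μ s : ℝ) (F : ℝ → ℝ≥0∞) (g : ℝ × ℝ → ℝ≥0∞) (z : ℝ × ℝ) (a : ℝ) : ℝ≥0∞ :=
  ENNReal.ofReal |dphase ν μ a - dphase ν μ (z.1 - a)| ^ s * (F a * g (z - (a, phase ν μ a)))

theorem measurable_shift (ν μ : ℝ) :
    Measurable fun p : (ℝ × ℝ) × ℝ => p.1 - (p.2, phase ν μ p.2) := by
  have := (continuous_phase ν μ).measurable
  fun_prop

theorem measurable_symbol (ν μ s : ℝ) : Measurable fun p : (ℝ × ℝ) × ℝ =>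
    ENNReal.ofReal |dphase ν μ p.2 - dphase ν μ (p.1.1 - p.2)| ^ s := by
  have := continuous_dphase ν μ
  exact (Measurable.ennreal_ofReal (Continuous.measurable (by fun_prop))).pow_const s

theorem measurable_surfaceIntegrand (ν μ s : ℝ) {F : ℝ → ℝ≥0∞} {g : ℝ × ℝ → ℝ≥0∞}
    (hF : Measurable F) (hg : Measurable g) :
    Measurable fun p : (ℝ × ℝ) × ℝ => surfaceIntegrand ν μ s F g p.1 p.2 :=
  (measurable_symbol ν μ s).mul
    ((hF.comp measurable_snd).mul (hg.comp (measurable_shift ν μ)))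

theorem measurable_comp_shift (ν μ : ℝ) {g : ℝ × ℝ → ℝ≥0∞} (hg : Measurable g) (z : ℝ × ℝ) :
    Measurable fun a => g (z - (a, phase ν μ a)) := by
  have h := (continuous_phase ν μ).measurable
  have h2 : Measurable fun a => z - (a, phase ν μ a) := by fun_prop
  exact hg.comp h2

theorem measurable_symbol_right (ν μ s ξ : ℝ) :
    Measurable fun a => ENNReal.ofReal |dphase ν μ a - dphase ν μ (ξ - a)| ^ s := by
  have := continuous_dphase ν μ
  exact (Measurable.ennreal_ofReal (Continuous.measurable (by fun_prop))).pow_const s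

theorem sq_setLIntegral_surfaceIntegrand_le (ν μ : ℝ) {s : ℝ} {F : ℝ → ℝ≥0∞}
    {g : ℝ × ℝ → ℝ≥0∞} (hF : Measurable F) (hg : Measurable g) {M : ℝ}
    (hsupp : ∀ z, g z ≠ 0 → |z.2 - phase ν μ z.1| ≤ M) (I : Set ℝ) (z : ℝ × ℝ) :
    (∫⁻ a in I, surfaceIntegrand ν μ s F g z a) ^ 2
      ≤ (∫⁻ a in I ∩ {a | |z.2 - (phase ν μ a + phase ν μ (z.1 - a))| ≤ M},
          ENNReal.ofReal |dphase ν μ a - dphase ν μ (z.1 - a)| ^ (2 * s)) *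
        ∫⁻ a in I, F a ^ 2 * g (z - (a, phase ν μ a)) ^ 2 := by
  set E := {a | |z.2 - (phase ν μ a + phase ν μ (z.1 - a))| ≤ M} with hE
  have hEm : MeasurableSet E := by
    have := continuous_phase ν μ
    exact (isClosed_le (by fun_prop) continuous_const).measurableSet
  have hk : Measurable fun a => ENNReal.ofReal |dphase ν μ a - dphase ν μ (z.1 - a)| ^ s :=
    measurable_symbol_right ν μ s z.1
  have hg' : Measurable fun a => g (z - (a, phase ν μ a)) :=
    measurable_comp_shift ν μ hg z
  have e : ∀ a, surfaceIntegrand ν μ s F g z a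
      = E.indicator (fun a => ENNReal.ofReal |dphase ν μ a - dphase ν μ (z.1 - a)| ^ s) a *
        (F a * g (z - (a, phase ν μ a))) := fun a => by
    by_cases ha : a ∈ E
    · rw [Set.indicator_of_mem ha, surfaceIntegrand]
    · have : g (z - (a, phase ν μ a)) = 0 := by
        by_contra h
        refine ha ?_
        have := hsupp _ h
        simp only [Prod.fst_sub, Prod.snd_sub] at this
        rwa [hE, Set.mem_ofPred_eq, ← sub_sub]
      rw [surfaceIntegrand, this]
      simp
  simp only [e]
  refine (sq_lintegral_mul_le _ (hk.indicator hEm).aemeasurable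
    (hF.mul hg').aemeasurable).trans (mul_le_mul' (le_of_eq ?_) (le_of_eq ?_))
  · rw [Set.inter_comm, ← Measure.restrict_restrict hEm, ← lintegral_indicator hEm]
    refine lintegral_congr fun a => ?_
    by_cases ha : a ∈ E
    · simp only [Set.indicator_of_mem ha]
      rw [← ENNReal.rpow_natCast, ← ENNReal.rpow_mul, mul_comm]
      norm_num
    · simp [Set.indicator_of_notMem ha]
  · exact lintegral_congr fun a => mul_pow _ _ _

theorem lintegral_setLIntegral_surface_le (ν μ : ℝ) {F : ℝ → ℝ≥0∞} {g : ℝ × ℝ → ℝ≥0∞}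
    (hF : Measurable F) (hg : Measurable g) {R : Set (ℝ × ℝ)} {I B : Set ℝ}
    (hR : MeasurableSet R) (hI : MeasurableSet I) (hB : MeasurableSet B)
    (hRB : ∀ z ∈ R, ∀ a ∈ I, z.1 - a ∈ B) :
    ∫⁻ z in R, ∫⁻ a in I, F a ^ 2 * g (z - (a, phase ν μ a)) ^ 2
      ≤ (∫⁻ a in I, F a ^ 2) * ∫⁻ z, (Prod.fst ⁻¹' B).indicator (fun z => g z ^ 2) z := by
  set G := (Prod.fst ⁻¹' B).indicator (fun z : ℝ × ℝ => g z ^ 2) with hG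
  have hGm : Measurable G := (hg.pow_const 2).indicator (measurable_fst hB)
  have hGs : Measurable fun p : (ℝ × ℝ) × ℝ => F p.2 ^ 2 * G (p.1 - (p.2, phase ν μ p.2)) :=
    ((hF.comp measurable_snd).pow_const 2).mul (hGm.comp (measurable_shift ν μ))
  calc ∫⁻ z in R, ∫⁻ a in I, F a ^ 2 * g (z - (a, phase ν μ a)) ^ 2
      ≤ ∫⁻ z in R, ∫⁻ a in I, F a ^ 2 * G (z - (a, phase ν μ a)) := by
        refine setLIntegral_mono' hR fun z hz => setLIntegral_mono' hI fun a ha => ?_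
        rw [hG, Set.indicator_of_mem]
        exact hRB z hz a ha
    _ ≤ ∫⁻ z, ∫⁻ a in I, F a ^ 2 * G (z - (a, phase ν μ a)) :=
        setLIntegral_le_lintegral _ _
    _ = ∫⁻ a in I, ∫⁻ z, F a ^ 2 * G (z - (a, phase ν μ a)) :=
        lintegral_lintegral_swap hGs.aemeasurable
    _ = ∫⁻ a in I, F a ^ 2 * ∫⁻ z, G z := by
        refine lintegral_congr fun a => ?_
        have hm : Measurable fun z : ℝ × ℝ => G (z - (a, phase ν μ a)) :=
          hGm.comp (measurable_id.sub_const _)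
        rw [lintegral_const_mul _ hm, lintegral_sub_right_eq_self (fun z => G z)]
    _ = _ := lintegral_mul_const _ (hF.pow_const 2)

theorem setLIntegral_sq_surfaceIntegrand_le_of_window (ν μ : ℝ) {s : ℝ} {F : ℝ → ℝ≥0∞}
    {g : ℝ × ℝ → ℝ≥0∞} (hF : Measurable F) (hg : Measurable g) {M L : ℝ} (hL0 : 0 < L) {W : ℝ≥0∞}
    (hW : W ≠ ⊤) (hsupp : ∀ z, g z ≠ 0 → |z.2 - phase ν μ z.1| ≤ M)
    (hker : ∀ (ξ τ : ℝ) (I : Set ℝ), volume I ≤ ENNReal.ofReal L →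
      ∫⁻ a in I ∩ {a | |τ - (phase ν μ a + phase ν μ (ξ - a))| ≤ M},
        ENNReal.ofReal |dphase ν μ a - dphase ν μ (ξ - a)| ^ (2 * s) ≤ W)
    {R : Set (ℝ × ℝ)} (hRm : MeasurableSet R) (hR : ∀ z ∈ R, |z.1| < L) :
    ∫⁻ z in R, (∫⁻ a, surfaceIntegrand ν μ s F g z a) ^ 2
      ≤ 3 * W * ((∫⁻ a, F a ^ 2) * ∫⁻ z, g z ^ 2) := by
  have hsm := measurable_surfaceIntegrand ν μ s hF hg
  set S : ℝ → Set ℝ := fun c => Set.Ico c (c + L) with hS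
  set T : ℝ → Set ℝ := fun c => Set.Ioo (-2 * L - c) (L - c) with hT
  have hSm : MeasurableSet {p : ℝ × ℝ | p.2 ∈ S p.1} :=
    (measurableSet_le measurable_fst measurable_snd).inter
      (measurableSet_lt measurable_snd (measurable_fst.add_const L))
  have hTm : MeasurableSet {p : ℝ × (ℝ × ℝ) | p.2 ∈ Prod.fst ⁻¹' T p.1} :=
    (measurableSet_lt (by fun_prop : Measurable fun p : ℝ × (ℝ × ℝ) => -2 * L - p.1)
      (by fun_prop : Measurable fun p : ℝ × (ℝ × ℝ) => p.2.1)).inter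
      (measurableSet_lt (by fun_prop : Measurable fun p : ℝ × (ℝ × ℝ) => p.2.1)
      (by fun_prop : Measurable fun p : ℝ × (ℝ × ℝ) => L - p.1))
  have hSv : ∀ a, volume {c | a ∈ S c} = ENNReal.ofReal L := fun a => by
    have : {c | a ∈ S c} = Set.Ioc (a - L) a := by
      ext c
      simp only [hS, Set.mem_ofPred_eq, Set.mem_Ico, Set.mem_Ioc]
      constructor <;> rintro ⟨h1, h2⟩ <;> constructor <;> linarith
    rw [this, Real.volume_Ioc, sub_sub_cancel]
  have hTv : ∀ z : ℝ × ℝ, volume {c | z ∈ Prod.fst ⁻¹' T c} = ENNReal.ofReal (3 * L) := fun z => by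
    have : {c | z ∈ Prod.fst ⁻¹' T c} = Set.Ioo (-2 * L - z.1) (L - z.1) := by
      ext c
      simp only [hT, Set.mem_ofPred_eq, Set.mem_preimage, Set.mem_Ioo]
      constructor <;> rintro ⟨h1, h2⟩ <;> constructor <;> linarith
    rw [this, Real.volume_Ioo]
    congr 1
    ring
  have hhm : Measurable (Function.uncurry fun c z =>
      ∫⁻ a in S c, surfaceIntegrand ν μ s F g z a) :=
    measurable_setLIntegral_window volume hSm (f := fun z a => surfaceIntegrand ν μ s F g z a) hsm
  have hpm : Measurable fun c => ∫⁻ a in S c, F a ^ 2 := by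
    have h := measurable_setLIntegral_window (β := Unit) volume hSm (f := fun _ a => F a ^ 2)
      ((hF.pow_const 2).comp measurable_snd)
    exact h.comp (g := fun p : ℝ × Unit => ∫⁻ a in S p.1, F a ^ 2) (f := fun c => (c, ()))
      (by fun_prop)
  have hqm : Measurable fun c => ∫⁻ z in Prod.fst ⁻¹' T c, g z ^ 2 := by
    have h := measurable_setLIntegral_window (β := Unit) volume
      (S := fun c => Prod.fst ⁻¹' T c) hTm (f := fun _ z => g z ^ 2)
      ((hg.pow_const 2).comp measurable_snd)
    exact h.comp (g := fun p : ℝ × Unit => ∫⁻ z in Prod.fst ⁻¹' T p.1, g z ^ 2)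
      (f := fun c => (c, ())) (by fun_prop)
  have hwin := lintegral_sq_lintegral_le volume (volume.restrict R)
    (h := fun c z => ∫⁻ a in S c, surfaceIntegrand ν μ s F g z a)
    (A := W) (p := fun c => ∫⁻ a in S c, F a ^ 2)
    (q := fun c => ∫⁻ z in Prod.fst ⁻¹' T c, g z ^ 2)
    hhm hpm hqm
    (fun c => by
      have hpt : ∀ z : ℝ × ℝ, (∫⁻ a in S c, surfaceIntegrand ν μ s F g z a) ^ 2
          ≤ W * ∫⁻ a in S c, F a ^ 2 * g (z - (a, phase ν μ a)) ^ 2 := fun z =>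
        (sq_setLIntegral_surfaceIntegrand_le ν μ hF hg hsupp (S c) z).trans
          (mul_le_mul' (hker z.1 z.2 _ (by simp [hS])) le_rfl)
      refine (lintegral_mono hpt).trans ?_
      rw [lintegral_const_mul' _ _ hW]
      refine mul_le_mul' le_rfl ?_
      refine (lintegral_setLIntegral_surface_le ν μ hF hg hRm measurableSet_Ico
        (measurableSet_Ioo : MeasurableSet (T c)) fun z hz a ha => ?_).trans (le_of_eq ?_)
      · have hz' := hR z hz
        obtain ⟨h1, h2⟩ := abs_lt.1 hz'
        obtain ⟨h3, h4⟩ := ha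
        constructor <;> linarith
      · rw [lintegral_indicator (measurable_fst measurableSet_Ioo)])
  have hin : ∀ z, ∫⁻ c, ∫⁻ a in S c, surfaceIntegrand ν μ s F g z a
      = ENNReal.ofReal L * ∫⁻ a, surfaceIntegrand ν μ s F g z a := fun z => by
    have hz : Measurable (surfaceIntegrand ν μ s F g z) :=
      hsm.comp (f := fun a => (z, a)) measurable_prodMk_left
    exact lintegral_setLIntegral_window volume hSm hSv hz
  simp only [hin] at hwin
  rw [lintegral_setLIntegral_window volume hSm hSv (hF.pow_const 2),
    lintegral_setLIntegral_window volume (S := fun c => Prod.fst ⁻¹' T c) hTm hTv (hg.pow_const 2)] at hwin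
  simp only [mul_pow] at hwin
  rw [lintegral_const_mul' _ _ (by simp)] at hwin
  have hne : ENNReal.ofReal L ^ 2 ≠ 0 := by simpa using hL0
  refine (ENNReal.mul_le_mul_iff_right hne (by simp)).1 (hwin.trans (le_of_eq ?_))
  rw [ENNReal.ofReal_mul (by norm_num), ENNReal.ofReal_ofNat]
  ring

/-- The bilinear estimate when the second factor has modulation at most `m³`. -/
theorem exists_lintegral_sq_surfaceIntegrand_le {ν μ : ℝ} (hμ : μ ≠ 0) {s : ℝ} (hs0 : 0 ≤ s)
    (hs1 : s ≤ 1 / 2) : ∃ C > (0 : ℝ), ∀ m ≥ (1 : ℝ), ∀ (F : ℝ → ℝ≥0∞) (g : ℝ × ℝ → ℝ≥0∞),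
      Measurable F → Measurable g → (∀ z, g z ≠ 0 → |z.2 - phase ν μ z.1| ≤ m ^ 3) →
      ∫⁻ z, (∫⁻ a, surfaceIntegrand ν μ s F g z a) ^ 2
        ≤ ENNReal.ofReal (C * m ^ (1 + 4 * s)) * ((∫⁻ a, F a ^ 2) * ∫⁻ z, g z ^ 2) := by
  obtain ⟨K, hK, C, hC, hker⟩ := exists_setLIntegral_symbol_le (ν := ν) hμ hs0 hs1
  refine ⟨4 * C, by positivity, fun m hm F g hF hg hsupp => ?_⟩
  have hm0 : 0 < m := by linarith
  set W := ENNReal.ofReal (C * m ^ (1 + 4 * s)) with hW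
  set L := K * m with hL
  have hL0 : 0 < L := by positivity
  have hsm := measurable_surfaceIntegrand ν μ s hF hg
  set R : Set (ℝ × ℝ) := {z | L ≤ |z.1|} with hR
  have hRm : MeasurableSet R := (isClosed_le continuous_const (by fun_prop)).measurableSet
  have hhigh : ∫⁻ z in R, (∫⁻ a, surfaceIntegrand ν μ s F g z a) ^ 2
      ≤ W * ((∫⁻ a, F a ^ 2) * ∫⁻ z, g z ^ 2) := by
    have hpt : ∀ z ∈ R, (∫⁻ a, surfaceIntegrand ν μ s F g z a) ^ 2
        ≤ W * ∫⁻ a in Set.univ, F a ^ 2 * g (z - (a, phase ν μ a)) ^ 2 := fun z hz => by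
      rw [← setLIntegral_univ]
      exact (sq_setLIntegral_surfaceIntegrand_le ν μ hF hg hsupp Set.univ z).trans
        (mul_le_mul' (hker m hm z.1 z.2 _ (Or.inl hz)) le_rfl)
    refine (setLIntegral_mono' hRm hpt).trans ?_
    rw [lintegral_const_mul' _ _ ENNReal.ofReal_ne_top]
    refine mul_le_mul' le_rfl ?_
    have := lintegral_setLIntegral_surface_le ν μ hF hg hRm MeasurableSet.univ MeasurableSet.univ
      (fun _ _ _ _ => Set.mem_univ _)
    simpa using this
  have hlow : ∫⁻ z in Rᶜ, (∫⁻ a, surfaceIntegrand ν μ s F g z a) ^ 2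
      ≤ 3 * W * ((∫⁻ a, F a ^ 2) * ∫⁻ z, g z ^ 2) := by
    exact setLIntegral_sq_surfaceIntegrand_le_of_window ν μ hF hg hL0 ENNReal.ofReal_ne_top hsupp
      (fun ξ τ I hI => hker m hm ξ τ I (Or.inr hI)) hRm.compl fun z hz => not_le.1 hz
  rw [← lintegral_add_compl _ hRm]
  refine (add_le_add hhigh hlow).trans (le_of_eq ?_)
  rw [show 4 * C * m ^ (1 + 4 * s) = 4 * (C * m ^ (1 + 4 * s)) by ring,
    ENNReal.ofReal_mul (by norm_num), ← hW, ENNReal.ofReal_ofNat]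
  ring

theorem exists_measurable_modulation_index : ∃ κ : ℝ → ℕ, Measurable κ ∧
    ∀ σ, |σ| ≤ ((2 : ℝ) ^ κ σ) ^ 3 ∧ ((2 : ℝ) ^ κ σ) ^ 6 ≤ 128 * (1 + σ ^ 2) := by
  refine ⟨fun σ => ⌈Real.logb 8 (1 + |σ|)⌉₊, ?_, fun σ => ?_⟩
  · refine Nat.measurable_ceil.comp ?_
    unfold Real.logb
    exact (Real.measurable_log.comp (by fun_prop)).div_const _
  · obtain ⟨k, hk⟩ : ∃ k : ℕ, k = ⌈Real.logb 8 (1 + |σ|)⌉₊ := ⟨_, rfl⟩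
    have h1 : 1 ≤ 1 + |σ| := by linarith [abs_nonneg σ]
    have h0 : 0 ≤ Real.logb 8 (1 + |σ|) := Real.logb_nonneg (by norm_num) h1
    have e : ((2 : ℝ) ^ k) ^ 3 = 8 ^ (k : ℝ) := by
      rw [Real.rpow_natCast, ← pow_mul, mul_comm, pow_mul]
      norm_num
    have hlog : (8 : ℝ) ^ Real.logb 8 (1 + |σ|) = 1 + |σ| :=
      Real.rpow_logb (by norm_num) (by norm_num) (by linarith)
    have hlow : 1 + |σ| ≤ ((2 : ℝ) ^ k) ^ 3 := by
      rw [e]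
      conv_lhs => rw [← hlog]
      exact Real.rpow_le_rpow_of_exponent_le (by norm_num) (by rw [hk]; exact Nat.le_ceil _)
    have hup : ((2 : ℝ) ^ k) ^ 3 ≤ 8 * (1 + |σ|) := by
      rw [e]
      calc (8 : ℝ) ^ (k : ℝ) ≤ 8 ^ (1 + Real.logb 8 (1 + |σ|)) :=
            Real.rpow_le_rpow_of_exponent_le (by norm_num)
              (by rw [hk]; linarith [Nat.ceil_lt_add_one h0])
        _ = _ := by rw [Real.rpow_add (by norm_num), Real.rpow_one, hlog]
    simp only [← hk]
    refine ⟨by linarith, ?_⟩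
    calc ((2 : ℝ) ^ k) ^ 6 = (((2 : ℝ) ^ k) ^ 3) ^ 2 := by ring
      _ ≤ (8 * (1 + |σ|)) ^ 2 := by gcongr
      _ ≤ 128 * (1 + σ ^ 2) := by nlinarith [sq_abs σ, sq_nonneg (1 - |σ|)]

/-- The bilinear estimate with the first factor on the characteristic surface. -/
theorem exists_lintegral_sq_surfaceIntegrand_le_weight {ν μ : ℝ} (hμ : μ ≠ 0) {s : ℝ} (hs0 : 0 ≤ s)
    (hs1 : s ≤ 1 / 2) {b : ℝ} (hb : 1 / 6 + 2 / 3 * s < b) :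
    ∃ C : ℝ≥0∞, C ≠ ⊤ ∧ ∀ (F : ℝ → ℝ≥0∞) (g : ℝ × ℝ → ℝ≥0∞), Measurable F → Measurable g →
      ∫⁻ z, (∫⁻ a, surfaceIntegrand ν μ s F g z a) ^ 2
        ≤ C * ((∫⁻ a, F a ^ 2) *
          ∫⁻ z, ENNReal.ofReal ((1 + (z.2 - phase ν μ z.1) ^ 2) ^ b) * g z ^ 2) := by
  obtain ⟨C, hC, hloc⟩ := exists_lintegral_sq_surfaceIntegrand_le (ν := ν) hμ hs0 hs1
  obtain ⟨κ, hκm, hκ⟩ := exists_measurable_modulation_index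
  set r : ℝ := 1 + 4 * s - 6 * b with hr
  have hr0 : r < 0 := by rw [hr]; linarith
  have hb0 : 0 < b := by linarith
  have hsum : ∑' k : ℕ, ENNReal.ofReal (((2 : ℝ) ^ k) ^ r) ≠ ⊤ := by
    have hlt : (2 : ℝ) ^ r < 1 := Real.rpow_lt_one_of_one_lt_of_neg (by norm_num) hr0
    have e : ∀ k : ℕ, ((2 : ℝ) ^ k) ^ r = ((2 : ℝ) ^ r) ^ k := fun k => by
      rw [← Real.rpow_natCast, ← Real.rpow_mul (by norm_num), mul_comm,
        Real.rpow_mul (by norm_num), Real.rpow_natCast]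
    simp only [e]
    exact (summable_geometric_of_lt_one (by positivity) hlt).tsum_ofReal_ne_top
  refine ⟨ENNReal.ofReal C * (∑' k : ℕ, ENNReal.ofReal (((2 : ℝ) ^ k) ^ r)) *
    ENNReal.ofReal (128 ^ b), ENNReal.mul_ne_top (ENNReal.mul_ne_top ENNReal.ofReal_ne_top hsum)
      ENNReal.ofReal_ne_top, fun F g hF hg => ?_⟩
  have hφ := (continuous_phase ν μ).measurable
  set idx : ℝ × ℝ → ℕ := fun z => κ (z.2 - phase ν μ z.1) with hidx
  have hidxm : Measurable idx := hκm.comp (by fun_prop)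
  have hset : ∀ k, MeasurableSet (idx ⁻¹' {k}) := fun k => hidxm (measurableSet_singleton k)
  set gk : ℕ → ℝ × ℝ → ℝ≥0∞ := fun k => (idx ⁻¹' {k}).indicator g with hgk
  have hgkm : ∀ k, Measurable (gk k) := fun k => hg.indicator (hset k)
  have hsupp : ∀ k z, gk k z ≠ 0 → |z.2 - phase ν μ z.1| ≤ ((2 : ℝ) ^ k) ^ 3 := fun k z hz => by
    have : idx z = k := Set.mem_of_indicator_ne_zero (s := idx ⁻¹' {k}) (f := g) hz
    rw [← this]
    exact (hκ _).1
  have hgsum : ∀ z, ∑' k, gk k z = g z := fun z => by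
    rw [tsum_eq_single (idx z) fun k hk => Set.indicator_of_notMem (fun h => hk h.symm) _]
    exact Set.indicator_of_mem (s := idx ⁻¹' {idx z}) rfl g
  have hsm : ∀ k, Measurable fun p : (ℝ × ℝ) × ℝ => surfaceIntegrand ν μ s F (gk k) p.1 p.2 :=
    fun k => measurable_surfaceIntegrand ν μ s hF (hgkm k)
  have hdecomp : ∀ z, ∫⁻ a, surfaceIntegrand ν μ s F g z a
      = ∫⁻ k, (∫⁻ a, surfaceIntegrand ν μ s F (gk k) z a) ∂(Measure.count) := fun z => by
    have hmk : ∀ k, AEMeasurable fun a => surfaceIntegrand ν μ s F (gk k) z a := fun k =>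
      ((hsm k).comp (f := fun a => (z, a)) measurable_prodMk_left).aemeasurable
    rw [lintegral_count, ← lintegral_tsum hmk]
    refine lintegral_congr fun a => ?_
    simp only [surfaceIntegrand, ENNReal.tsum_mul_left, hgsum]
  simp only [hdecomp]
  have hhm : Measurable (Function.uncurry fun (k : ℕ) z =>
      ∫⁻ a, surfaceIntegrand ν μ s F (gk k) z a) :=
    measurable_from_prod_countable_right fun k => Measurable.lintegral_prod_right' (hsm k)
  have hmain := lintegral_sq_lintegral_le (Measure.count : Measure ℕ) volume
    (h := fun k z => ∫⁻ a, surfaceIntegrand ν μ s F (gk k) z a)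
    (A := ENNReal.ofReal C * ∫⁻ a, F a ^ 2)
    (p := fun k => ENNReal.ofReal (((2 : ℝ) ^ k) ^ r))
    (q := fun k => ENNReal.ofReal (((2 : ℝ) ^ k) ^ (6 * b)) * ∫⁻ z, gk k z ^ 2)
    hhm
    (measurable_of_countable _) (measurable_of_countable _) (fun k => by
      refine (hloc (2 ^ k) (one_le_pow₀ (by norm_num)) F (gk k) hF (hgkm k) (hsupp k)).trans
        (le_of_eq ?_)
      have e : ((2 : ℝ) ^ k) ^ (1 + 4 * s) = ((2 : ℝ) ^ k) ^ r * ((2 : ℝ) ^ k) ^ (6 * b) := by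
        rw [← Real.rpow_add (by positivity), hr, sub_add_cancel]
      rw [e, ENNReal.ofReal_mul hC.le, ENNReal.ofReal_mul (by positivity)]
      ring)
  refine hmain.trans ?_
  have hq : ∫⁻ k : ℕ, ENNReal.ofReal (((2 : ℝ) ^ k) ^ (6 * b)) * (∫⁻ z, gk k z ^ 2) ∂(Measure.count)
      ≤ ENNReal.ofReal (128 ^ b) *
        ∫⁻ z, ENNReal.ofReal ((1 + (z.2 - phase ν μ z.1) ^ 2) ^ b) * g z ^ 2 := by
    rw [lintegral_count, ← lintegral_const_mul' _ _ ENNReal.ofReal_ne_top]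
    simp only [← lintegral_const_mul _ ((hgkm _).pow_const 2)]
    rw [← lintegral_tsum fun k => (((hgkm k).pow_const 2).const_mul _).aemeasurable]
    refine lintegral_mono fun z => ?_
    rw [tsum_eq_single (idx z) fun k hk => by
      rw [hgk]
      simp only
      rw [Set.indicator_of_notMem (fun h => hk h.symm)]
      simp]
    have e : gk (idx z) z = g z :=
      Set.indicator_of_mem (s := idx ⁻¹' {idx z}) rfl g
    rw [e, ← mul_assoc, ← ENNReal.ofReal_mul (by positivity)]
    refine mul_le_mul' (ENNReal.ofReal_le_ofReal ?_) le_rfl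
    rw [← Real.mul_rpow (by norm_num) (by positivity), Real.rpow_mul (by positivity)]
    refine Real.rpow_le_rpow (by positivity) ?_ hb0.le
    have := (hκ (z.2 - phase ν μ z.1)).2
    exact_mod_cast this
  refine (mul_le_mul' le_rfl (mul_le_mul' (le_of_eq (lintegral_count _)) hq)).trans (le_of_eq ?_)
  ring

/-- The bilinear estimate for general nonnegative factors, in weighted `L²` form. -/
theorem exists_lintegral_sq_bilinear_le {ν μ : ℝ} (hμ : μ ≠ 0) {s : ℝ} (hs0 : 0 ≤ s)
    (hs1 : s ≤ 1 / 2) {b : ℝ} (hb : 1 / 2 < b) {bt : ℝ} (hbt : 1 / 6 + 2 / 3 * s < bt) :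
    ∃ C : ℝ≥0∞, C ≠ ⊤ ∧ ∀ f g : ℝ × ℝ → ℝ≥0∞, Measurable f → Measurable g →
      ∫⁻ z : ℝ × ℝ, (∫⁻ a, ∫⁻ t, ENNReal.ofReal |dphase ν μ a - dphase ν μ (z.1 - a)| ^ s *
          (f (a, t) * g (z - (a, t)))) ^ 2
        ≤ C * ((∫⁻ z, ENNReal.ofReal ((1 + (z.2 - phase ν μ z.1) ^ 2) ^ b) * f z ^ 2) *
          ∫⁻ z, ENNReal.ofReal ((1 + (z.2 - phase ν μ z.1) ^ 2) ^ bt) * g z ^ 2) := by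
  obtain ⟨C, hC, hsurf⟩ := exists_lintegral_sq_surfaceIntegrand_le_weight (ν := ν) hμ hs0 hs1 hbt
  have hint : ∫⁻ σ : ℝ, ENNReal.ofReal ((1 + σ ^ 2) ^ (-b)) ≠ ⊤ := by
    have h := integrable_rpow_neg_one_add_norm_sq (E := ℝ) (μ := volume) (r := 2 * b)
      (by simp only [Module.finrank_self, Nat.cast_one]; linarith)
    have e : ∀ σ : ℝ, (1 + ‖σ‖ ^ 2) ^ (-(2 * b) / 2) = (1 + σ ^ 2) ^ (-b) := fun σ => by
      rw [Real.norm_eq_abs, sq_abs]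
      congr 1
      ring
    simp only [e] at h
    exact h.lintegral_lt_top.ne
  refine ⟨C * ∫⁻ σ : ℝ, ENNReal.ofReal ((1 + σ ^ 2) ^ (-b)), ENNReal.mul_ne_top hC hint,
    fun f g hf hg => ?_⟩
  have hφ := (continuous_phase ν μ).measurable
  set G := ∫⁻ z, ENNReal.ofReal ((1 + (z.2 - phase ν μ z.1) ^ 2) ^ bt) * g z ^ 2 with hG
  set F : ℝ → ℝ → ℝ≥0∞ := fun σ a => f (a, σ + phase ν μ a) with hF
  have hFm : Measurable (Function.uncurry F) :=
    hf.comp (f := fun p : ℝ × ℝ => (p.2, p.1 + phase ν μ p.2)) (by fun_prop)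
  have hFm' : ∀ σ, Measurable (F σ) := fun σ => hFm.comp measurable_prodMk_left
  have hsub : ∀ (z : ℝ × ℝ) (σ a : ℝ), z - (a, σ + phase ν μ a) = z - (0, σ) - (a, phase ν μ a) :=
    fun z σ a => by ext <;> (simp; try ring)
  have hJ := measurable_symbol ν μ s
  have hjoint : Measurable fun q : (ℝ × (ℝ × ℝ)) × ℝ =>
      surfaceIntegrand ν μ s (F q.1.1) g (q.1.2 - (0, q.1.1)) q.2 := by
    have h1 : Measurable fun q : (ℝ × (ℝ × ℝ)) × ℝ =>
        ENNReal.ofReal |dphase ν μ q.2 - dphase ν μ ((q.1.2 - (0, q.1.1)).1 - q.2)| ^ s :=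
      hJ.comp (f := fun q : (ℝ × (ℝ × ℝ)) × ℝ => (q.1.2 - (0, q.1.1), q.2)) (by fun_prop)
    have h2 : Measurable fun q : (ℝ × (ℝ × ℝ)) × ℝ => F q.1.1 q.2 :=
      hFm.comp (f := fun q : (ℝ × (ℝ × ℝ)) × ℝ => (q.1.1, q.2)) (by fun_prop)
    have h3 : Measurable fun q : (ℝ × (ℝ × ℝ)) × ℝ =>
        g (q.1.2 - (0, q.1.1) - (q.2, phase ν μ q.2)) :=
      hg.comp (f := fun q : (ℝ × (ℝ × ℝ)) × ℝ => q.1.2 - (0, q.1.1) - (q.2, phase ν μ q.2))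
        (by fun_prop)
    exact h1.mul (h2.mul h3)
  have hswap : ∀ z : ℝ × ℝ,
      ∫⁻ a, ∫⁻ t, ENNReal.ofReal |dphase ν μ a - dphase ν μ (z.1 - a)| ^ s *
          (f (a, t) * g (z - (a, t)))
        = ∫⁻ σ, ∫⁻ a, surfaceIntegrand ν μ s (F σ) g (z - (0, σ)) a := fun z => by
    have hz : Measurable fun p : ℝ × ℝ => surfaceIntegrand ν μ s (F p.1) g (z - (0, p.1)) p.2 :=
      hjoint.comp (f := fun p : ℝ × ℝ => ((p.1, z), p.2)) (by fun_prop)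
    refine Eq.trans (lintegral_congr fun a => ?_) (lintegral_lintegral_swap hz.aemeasurable).symm
    refine (lintegral_add_right_eq_self _ (phase ν μ a)).symm.trans ?_
    refine lintegral_congr fun σ => ?_
    rw [surfaceIntegrand, ← hsub, Prod.fst_sub, sub_zero]
  simp only [hswap]
  have hhm : Measurable (Function.uncurry fun σ (z : ℝ × ℝ) =>
      ∫⁻ a, surfaceIntegrand ν μ s (F σ) g (z - (0, σ)) a) := Measurable.lintegral_prod_right' hjoint
  have hpm : Measurable fun σ : ℝ => ENNReal.ofReal ((1 + σ ^ 2) ^ (-b)) := by fun_prop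
  have hFsq : Measurable fun σ => ∫⁻ a, F σ a ^ 2 :=
    Measurable.lintegral_prod_right' (f := fun p => Function.uncurry F p ^ 2) (hFm.pow_const 2)
  have hwm : Measurable fun σ : ℝ => ENNReal.ofReal ((1 + σ ^ 2) ^ b) := by fun_prop
  have hmain := lintegral_sq_lintegral_le volume volume hhm (A := C * G) hpm (hwm.mul hFsq)
    (fun σ => by
      have htr := lintegral_sub_right_eq_self (μ := (volume : Measure (ℝ × ℝ)))
        (fun z => (∫⁻ a, surfaceIntegrand ν μ s (F σ) g z a) ^ 2) (0, σ)
      rw [htr]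
      refine (hsurf (F σ) g (hFm' σ) hg).trans (le_of_eq ?_)
      have e : ENNReal.ofReal ((1 + σ ^ 2) ^ (-b)) * ENNReal.ofReal ((1 + σ ^ 2) ^ b) = 1 := by
        rw [← ENNReal.ofReal_mul (by positivity), ← Real.rpow_add (by positivity)]
        simp
      simp only [Pi.mul_apply]
      rw [← mul_assoc (ENNReal.ofReal _), e, one_mul, ← hG]
      ring)
  refine hmain.trans (le_of_eq ?_)
  have hq : ∫⁻ σ : ℝ, ENNReal.ofReal ((1 + σ ^ 2) ^ b) * ∫⁻ a, F σ a ^ 2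
      = ∫⁻ z, ENNReal.ofReal ((1 + (z.2 - phase ν μ z.1) ^ 2) ^ b) * f z ^ 2 := by
    have hm : Measurable fun z : ℝ × ℝ =>
        ENNReal.ofReal ((1 + (z.2 - phase ν μ z.1) ^ 2) ^ b) * f z ^ 2 :=
      (hwm.comp (f := fun z : ℝ × ℝ => z.2 - phase ν μ z.1) (by fun_prop)).mul (hf.pow_const 2)
    have hm' : Measurable fun p : ℝ × ℝ => ENNReal.ofReal ((1 + p.1 ^ 2) ^ b) * F p.1 p.2 ^ 2 :=
      (hwm.comp measurable_fst).mul (hFm.pow_const 2)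
    rw [Measure.volume_eq_prod, lintegral_prod _ hm.aemeasurable]
    simp only [← lintegral_const_mul' _ _ ENNReal.ofReal_ne_top]
    rw [lintegral_lintegral_swap hm'.aemeasurable]
    refine lintegral_congr fun a => ?_
    refine Eq.trans ?_ (lintegral_add_right_eq_self _ (phase ν μ a))
    refine lintegral_congr fun σ => ?_
    simp only [hF, add_sub_cancel_right]
  simp only [Pi.mul_apply]
  rw [hq]
  ring

theorem measurable_FT2 {u : ℝ → ℝ → ℂ} (hu : Measurable (Function.uncurry u)) :
    Measurable (Function.uncurry (FT2 u)) := by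
  have h1 : StronglyMeasurable fun q : (ℝ × ℝ) × ℝ =>
      ∫ t : ℝ, Complex.exp (-(Complex.I * (q.1.1 * q.2 + q.1.2 * t))) * u q.2 t := by
    refine StronglyMeasurable.integral_prod_right' (f := fun r : ((ℝ × ℝ) × ℝ) × ℝ =>
      Complex.exp (-(Complex.I * (r.1.1.1 * r.1.2 + r.1.1.2 * r.2))) * u r.1.2 r.2) ?_
    refine Measurable.stronglyMeasurable (Measurable.mul (by fun_prop) ?_)
    exact hu.comp (f := fun r : ((ℝ × ℝ) × ℝ) × ℝ => (r.1.2, r.2)) (by fun_prop)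
  exact (StronglyMeasurable.integral_prod_right' h1).measurable

theorem measurable_IsHat (ν μ s : ℝ) {u v : ℝ → ℝ → ℂ} (hu : Measurable (Function.uncurry u))
    (hv : Measurable (Function.uncurry v)) :
    Measurable (Function.uncurry (IsHat ν μ s u v)) := by
  have hd := (continuous_dphase ν μ).measurable
  have h1 : StronglyMeasurable fun q : (ℝ × ℝ) × ℝ => ∫ τ₁ : ℝ,
      (↑(|dphase ν μ q.2 - dphase ν μ (q.1.1 - q.2)| ^ s) : ℂ) *
        (FT2 u q.2 τ₁ * FT2 v (q.1.1 - q.2) (q.1.2 - τ₁)) := by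
    refine StronglyMeasurable.integral_prod_right' (f := fun r : ((ℝ × ℝ) × ℝ) × ℝ =>
      (↑(|dphase ν μ r.1.2 - dphase ν μ (r.1.1.1 - r.1.2)| ^ s) : ℂ) *
        (FT2 u r.1.2 r.2 * FT2 v (r.1.1.1 - r.1.2) (r.1.1.2 - r.2))) ?_
    refine Measurable.stronglyMeasurable (Measurable.mul ?_ (Measurable.mul ?_ ?_))
    · have : Measurable fun r : ((ℝ × ℝ) × ℝ) × ℝ =>
          |dphase ν μ r.1.2 - dphase ν μ (r.1.1.1 - r.1.2)| := by fun_prop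
      exact Complex.measurable_ofReal.comp (this.pow_const s)
    · exact (measurable_FT2 hu).comp (f := fun r : ((ℝ × ℝ) × ℝ) × ℝ => (r.1.2, r.2)) (by fun_prop)
    · exact (measurable_FT2 hv).comp
        (f := fun r : ((ℝ × ℝ) × ℝ) × ℝ => (r.1.1.1 - r.1.2, r.1.1.2 - r.2)) (by fun_prop)
  exact (StronglyMeasurable.integral_prod_right' h1).measurable

theorem enorm_IsHat_le (ν μ : ℝ) {s : ℝ} (hs : 0 ≤ s) (u v : ℝ → ℝ → ℂ) (z : ℝ × ℝ) :
    ‖IsHat ν μ s u v z.1 z.2‖ₑ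
      ≤ ∫⁻ a, ∫⁻ t, ENNReal.ofReal |dphase ν μ a - dphase ν μ (z.1 - a)| ^ s *
          (‖FT2 u a t‖ₑ * ‖FT2 v (z.1 - a) (z.2 - t)‖ₑ) := by
  refine (enorm_integral_le_lintegral_enorm _).trans (lintegral_mono fun a =>
    (enorm_integral_le_lintegral_enorm _).trans (le_of_eq (lintegral_congr fun t => ?_)))
  rw [enorm_mul, enorm_mul, ENNReal.ofReal_rpow_of_nonneg (abs_nonneg _) hs, ← ofReal_norm,
    Complex.norm_real, Real.norm_of_nonneg (by positivity)]

theorem XNorm_zero_eq (ν μ b : ℝ) {u : ℝ → ℝ → ℂ} (hu : Measurable (Function.uncurry u)) :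
    XNorm ν μ 0 b u = (∫⁻ z : ℝ × ℝ,
      ENNReal.ofReal ((1 + (z.2 - phase ν μ z.1) ^ 2) ^ b) * ‖FT2 u z.1 z.2‖ₑ ^ 2) ^ (1 / 2 : ℝ) := by
  have hφ := (continuous_phase ν μ).measurable
  have hm : Measurable fun z : ℝ × ℝ =>
      ENNReal.ofReal ((1 + (z.2 - phase ν μ z.1) ^ 2) ^ b) * ‖FT2 u z.1 z.2‖ₑ ^ 2 :=
    Measurable.mul (by fun_prop) ((measurable_FT2 hu).enorm.pow_const 2)
  rw [Measure.volume_eq_prod, lintegral_prod _ hm.aemeasurable, XNorm]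
  simp only [Real.rpow_zero, one_mul]
  rfl

/-- **Corollary 2.6** (interpolated bilinear estimate): for every `s ∈ [0, 1/2]`,
`b > 1/2` and `b̃ > 1/6 + (2/3)s` there is `C > 0`, depending only on
`ν, μ, s, b, b̃`, such that
`‖I^s(u,v)‖_{L²(ℝ²)} ≤ C ‖u‖_{X_{0,b}} ‖v‖_{X_{0,b̃}}` for all Schwartz `u, v`. -/
theorem benjamin_bilinear_interp (ν μ : ℝ) (hμ : μ ≠ 0)
    (s : ℝ) (hs : s ∈ Set.Icc (0 : ℝ) (1 / 2)) (b : ℝ) (hb : 1 / 2 < b)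
    (bt : ℝ) (hbt : 1 / 6 + 2 / 3 * s < bt) :
    ∃ C > (0 : ℝ), ∀ u v : SchwartzMap (ℝ × ℝ) ℂ,
      eLpNorm
          (fun z : ℝ × ℝ =>
            IsOp ν μ s (fun x t => u (x, t)) (fun x t => v (x, t)) z.1 z.2) 2
          (volume : Measure (ℝ × ℝ)) ≤
        ENNReal.ofReal C *
          (XNorm ν μ 0 b (fun x t => u (x, t)) * XNorm ν μ 0 bt (fun x t => v (x, t))) := by
  obtain ⟨K, hK, hbil⟩ := exists_lintegral_sq_bilinear_le (ν := ν) hμ hs.1 hs.2 hb hbt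
  set A : ℝ≥0∞ := ‖(((2 * π) ^ 2)⁻¹ : ℝ)‖ₑ ^ 2 * (ENNReal.ofReal (2 * π) ^ 2 * K) with hA
  have hA' : A ^ (1 / 2 : ℝ) ≠ ⊤ := ENNReal.rpow_ne_top_of_nonneg (by norm_num)
    (ENNReal.mul_ne_top (ENNReal.pow_ne_top enorm_ne_top)
      (ENNReal.mul_ne_top (ENNReal.pow_ne_top ENNReal.ofReal_ne_top) hK))
  refine ⟨(A ^ (1 / 2 : ℝ)).toReal + 1, by positivity, fun u v => ?_⟩
  have hu : Measurable (Function.uncurry fun x t => u (x, t)) := u.continuous.measurable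
  have hv : Measurable (Function.uncurry fun x t => v (x, t)) := v.continuous.measurable
  rw [XNorm_zero_eq ν μ b hu, XNorm_zero_eq ν μ bt hv]
  set U := FT2 fun x t => u (x, t)
  set V := FT2 fun x t => v (x, t)
  set w := IsHat ν μ s (fun x t => u (x, t)) (fun x t => v (x, t)) with hw
  have hhat : ∫⁻ z : ℝ × ℝ, ‖w z.1 z.2‖ₑ ^ 2
      ≤ K * ((∫⁻ z : ℝ × ℝ,
          ENNReal.ofReal ((1 + (z.2 - phase ν μ z.1) ^ 2) ^ b) * ‖U z.1 z.2‖ₑ ^ 2) *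
        ∫⁻ z : ℝ × ℝ,
          ENNReal.ofReal ((1 + (z.2 - phase ν μ z.1) ^ 2) ^ bt) * ‖V z.1 z.2‖ₑ ^ 2) :=
    (lintegral_mono fun z => pow_le_pow_left₀ zero_le (enorm_IsHat_le ν μ hs.1 _ _ z) 2).trans
      (hbil (fun z => ‖U z.1 z.2‖ₑ) (fun z => ‖V z.1 z.2‖ₑ) (measurable_FT2 hu).enorm
        (measurable_FT2 hv).enorm)
  have hsq : eLpNorm (fun z : ℝ × ℝ =>
      IsOp ν μ s (fun x t => u (x, t)) (fun x t => v (x, t)) z.1 z.2) 2 volume ^ 2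
        ≤ ‖(((2 * π) ^ 2)⁻¹ : ℝ)‖ₑ ^ 2 *
          (ENNReal.ofReal (2 * π) ^ 2 * ∫⁻ z : ℝ × ℝ, ‖w z.1 z.2‖ₑ ^ 2) := by
    rw [eLpNorm_two_sq]
    simp only [IsOp, enorm_smul, mul_pow]
    rw [lintegral_const_mul' _ _ (ENNReal.pow_ne_top enorm_ne_top)]
    exact mul_le_mul' le_rfl
      (lintegral_enorm_iterated_integral_exp_sq_le (measurable_IsHat ν μ s hu hv))
  have hroot : ∀ x : ℝ≥0∞, (x ^ 2) ^ (1 / 2 : ℝ) = x := fun x => by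
    rw [← ENNReal.rpow_natCast, ← ENNReal.rpow_mul]
    norm_num
  rw [← ENNReal.mul_rpow_of_nonneg _ _ (by norm_num), ← hroot (eLpNorm _ _ _)]
  refine (ENNReal.rpow_le_rpow (hsq.trans (mul_le_mul' le_rfl (mul_le_mul' le_rfl hhat)))
    (by norm_num)).trans ?_
  rw [← mul_assoc (ENNReal.ofReal (2 * π) ^ 2), ← mul_assoc (‖_‖ₑ ^ 2), ← hA,
    ENNReal.mul_rpow_of_nonneg _ _ (by norm_num)]
  refine mul_le_mul' ?_ le_rfl
  rw [← ENNReal.ofReal_toReal hA']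
  exact ENNReal.ofReal_le_ofReal (by rw [ENNReal.toReal_ofReal ENNReal.toReal_nonneg]; linarith)
end
end

section
/- There exists a constant c > 0, depending only on ν and μ, such that whenever ξ₁, ξ₂, ξ₃ ∈ ℝ satisfy ξ₁ + ξ₂ + ξ₃ = 0 and max(|ξ₁|, |ξ₂|, |ξ₃|) ≥ a, one has |φ(ξ₁) + φ(ξ₂) + φ(ξ₃)| ≥ c |ξ₁| |ξ₂| |ξ₃|. (Resonance function lower bound, the arithmetic fact (3.4)/(4.1); equivalently, with ξ = ξ₁ + ξ₂, |(τ − φ(ξ)) − (τ₁ − φ(ξ₁)) − (τ₂ − φ(ξ₂))| ≥ c|ξ||ξ₁||ξ₂| when τ = τ₁ + τ₂ and max(|ξ|,|ξ₁|,|ξ₂|) ≥ a.) -/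
open MeasureTheory Real
open scoped ENNReal NNReal Classical

noncomputable section

/-- The phase is an odd function. -/
theorem phase_neg (ν μ ξ : ℝ) : phase ν μ (-ξ) = -phase ν μ ξ := by
  simp only [phase, abs_neg]
  ring

/-- On nonnegative frequencies the resonance function factors. -/
theorem phase_add_phase_sub_phase_add (ν μ : ℝ) {x y : ℝ} (hx : 0 ≤ x) (hy : 0 ≤ y) :
    phase ν μ x + phase ν μ y - phase ν μ (x + y) = x * y * (2 * ν - 3 * μ * (x + y)) := by
  simp only [phase, abs_of_nonneg hx, abs_of_nonneg hy, abs_of_nonneg (add_nonneg hx hy)]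
  ring

/-- Above the threshold, the cubic part of the phase dominates the quadratic one. -/
theorem le_abs_sub_of_aconst_le {ν μ M : ℝ} (hμ : μ ≠ 0) (hM : aconst ν μ ≤ M) :
    3 * |μ| / 2 * M ≤ |2 * ν - 3 * μ * M| := by
  have hμ' : 0 < |μ| := abs_pos.mpr hμ
  have hMν : 2 * |2 * ν / (3 * μ)| ≤ M :=
    (mul_le_mul_of_nonneg_left (le_max_right _ _) zero_le_two).trans hM
  have hM0 : 0 ≤ M := le_trans (by positivity) hMν
  rw [abs_div, abs_mul 3 μ, abs_of_pos (three_pos : (0 : ℝ) < 3), ← mul_div_assoc,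
    div_le_iff₀ (by positivity)] at hMν
  have htri := abs_sub_abs_le_abs_sub (3 * μ * M) (2 * ν)
  rw [abs_sub_comm (3 * μ * M), abs_mul (3 * μ) M, abs_mul 3 μ,
    abs_of_pos (three_pos : (0 : ℝ) < 3), abs_of_nonneg hM0] at htri
  linarith

/-- The resonance bound for two nonnegative frequencies and minus their sum. -/
theorem resonance_le_of_nonneg {ν μ x y : ℝ} (hμ : μ ≠ 0) (hx : 0 ≤ x) (hy : 0 ≤ y)
    (ha : aconst ν μ ≤ x + y) :
    3 * |μ| / 2 * (x * y * (x + y)) ≤ |phase ν μ x + phase ν μ y - phase ν μ (x + y)| := by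
  rw [phase_add_phase_sub_phase_add ν μ hx hy, abs_mul, abs_of_nonneg (mul_nonneg hx hy)]
  calc 3 * |μ| / 2 * (x * y * (x + y)) = x * y * (3 * |μ| / 2 * (x + y)) := by ring
    _ ≤ _ := mul_le_mul_of_nonneg_left (le_abs_sub_of_aconst_le hμ ha) (mul_nonneg hx hy)

/-- The resonance bound when the first two frequencies have the same sign. -/
theorem resonance_le_of_mul_nonneg {ν μ x y z : ℝ} (hμ : μ ≠ 0) (hxy : 0 ≤ x * y)
    (hsum : x + y + z = 0) (ha : aconst ν μ ≤ max (max |x| |y|) |z|) :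
    3 * |μ| / 2 * (|x| * |y| * |z|) ≤ |phase ν μ x + phase ν μ y + phase ν μ z| := by
  obtain rfl : z = -(x + y) := by linarith
  have hadd : |x + y| = |x| + |y| := by
    rw [abs_add_eq_add_abs_iff]
    exact mul_nonneg_iff.mp hxy
  rw [abs_neg, hadd] at ha ⊢
  have ha' : aconst ν μ ≤ |x| + |y| := ha.trans <| max_le
    (max_le (le_add_of_nonneg_right (abs_nonneg y)) (le_add_of_nonneg_left (abs_nonneg x))) le_rfl
  have key := resonance_le_of_nonneg hμ (abs_nonneg x) (abs_nonneg y) ha'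
  rw [phase_neg]
  rcases mul_nonneg_iff.mp hxy with ⟨hx, hy⟩ | ⟨hx, hy⟩
  · simpa only [abs_of_nonneg hx, abs_of_nonneg hy, sub_eq_add_neg] using key
  · rw [← abs_neg (phase ν μ x + phase ν μ y + -phase ν μ (x + y))]
    rw [abs_of_nonpos hx, abs_of_nonpos hy, ← neg_add, phase_neg, phase_neg, phase_neg] at key
    rw [abs_of_nonpos hx, abs_of_nonpos hy, ← neg_add]
    convert key using 2
    ring

/-- **The resonance lower bound (3.4)/(4.1)**: there is `c > 0`, depending only on
`ν` and `μ`, such that whenever `ξ₁ + ξ₂ + ξ₃ = 0` and `max(|ξ₁|,|ξ₂|,|ξ₃|) ≥ a`,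
one has `|φ(ξ₁) + φ(ξ₂) + φ(ξ₃)| ≥ c |ξ₁||ξ₂||ξ₃|`. -/
theorem benjamin_resonance_lower_bound (ν μ : ℝ) (hμ : μ ≠ 0) :
    ∃ c > (0 : ℝ), ∀ ξ₁ ξ₂ ξ₃ : ℝ, ξ₁ + ξ₂ + ξ₃ = 0 →
      aconst ν μ ≤ max (max |ξ₁| |ξ₂|) |ξ₃| →
      c * (|ξ₁| * |ξ₂| * |ξ₃|) ≤ |phase ν μ ξ₁ + phase ν μ ξ₂ + phase ν μ ξ₃| := by
  refine ⟨3 * |μ| / 2, by positivity, fun x y z hsum ha => ?_⟩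
  by_cases hxy : 0 ≤ x * y
  · exact resonance_le_of_mul_nonneg hμ hxy hsum ha
  by_cases hyz : 0 ≤ y * z
  · have key := resonance_le_of_mul_nonneg (ν := ν) (z := x) hμ hyz (by linarith)
      (by rwa [max_comm, ← max_assoc])
    convert key using 1
    · ring
    · congr 1
      ring
  have hzx : 0 ≤ z * x := by
    by_contra hzx
    push Not at hxy hyz hzx
    nlinarith [mul_pos_of_neg_of_neg hxy hyz, sq_nonneg y]
  have key := resonance_le_of_mul_nonneg (ν := ν) (z := y) hμ hzx (by linarith)
    (by rwa [max_assoc, max_comm])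
  convert key using 1
  · ring
  · congr 1
    ring
end
end
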